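/- Let C be a non-hyperelliptic smooth connected projective complex curve of genus g with a base-point-free tetragonal system T such that h^0(2T) = 3, presented as a complete intersection of divisors in |O_X(2)(-aH)| and |O_X(2)(-bH)| on the 3-dimensional rational normal scroll X = P(V^∨) with a + b = g - 5 and T = H|_C. Then the algebra R_{K(-T)} = ⊕_{n≥0} H^0(C, (K(-T))^n) is quadratic if and only if a ≥ 2 and b ≥ 2. -/

import Mathlib

open TensorProduct Function

noncomputable section


/-!  ### Graded algebras presented by their components

An ℕ-graded algebra `R = ⊕ₙ Rₙ` over a field `k` (with `R₀ = k`) is presented here through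
its graded components, realized as `k`-subspaces `piece n` of an ambient `k`-algebra `A`,
with `1 ∈ piece 0` and `piece m * piece n ⊆ piece (m + n)`.  All notions below (Koszulness,
quadraticity) depend only on the components and the componentwise multiplication maps. -/
structure GradedSystem (k A : Type) [Field k] [Ring A] [Algebra k A] where
  piece : ℕ → Submodule k A
  one_mem : (1 : A) ∈ piece 0
  mul_mem : ∀ {m n : ℕ} {x y : A}, x ∈ piece m → y ∈ piece n → x * y ∈ piece (m + n)

namespace GradedSystem

variable {k A : Type} [Field k] [Ring A] [Algebra k A] (S : GradedSystem k A)

/-- The componentwise multiplication map `Rₘ ⊗ Rₙ → R_{m+n}`. -/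
def mulMap (m n : ℕ) : S.piece m →ₗ[k] S.piece n →ₗ[k] S.piece (m + n) :=
  LinearMap.mk₂ k (fun x y => ⟨(x : A) * (y : A), S.mul_mem x.2 y.2⟩)
    (fun x x' y => Subtype.ext (by simp [add_mul]))
    (fun c x y => Subtype.ext (by simp [smul_mul_assoc]))
    (fun x y y' => Subtype.ext (by simp [mul_add]))
    (fun c x y => Subtype.ext (by simp [mul_smul_comm]))

/-- Transport of a graded component along an equality of degrees. -/
def cast {m n : ℕ} (h : m = n) : (S.piece m : Type) ≃ₗ[k] S.piece n :=
  LinearEquiv.ofEq _ _ (by rw [h])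

/-- The degree-`d` component of the differential
`V_{i+1} ⊗ R(-(i+1)) → V_i ⊗ R(-i)` of a complex of free graded (right) `R`-modules with
`V_i = k^{n i}` generated in degree `i`; the differential is encoded by its
restriction `φ i : V_{i+1} → V_i ⊗ R₁` to the generators (a "matrix of linear forms").
The degree-`(i+1+d)` component of the map is `V_{i+1} ⊗ R_d → V_i ⊗ R_{d+1}`. -/
def Dmap (n : ℕ → ℕ)
    (φ : ∀ i : ℕ, (Fin (n (i + 1)) → k) →ₗ[k] ((Fin (n i) → k) ⊗[k] S.piece 1))
    (i d : ℕ) :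
    ((Fin (n (i + 1)) → k) ⊗[k] S.piece d) →ₗ[k] ((Fin (n i) → k) ⊗[k] S.piece (d + 1)) :=
  (LinearMap.lTensor (Fin (n i) → k)
      ((S.cast (add_comm 1 d)).toLinearMap ∘ₗ TensorProduct.lift (S.mulMap 1 d))) ∘ₗ
    (TensorProduct.assoc k (Fin (n i) → k) (S.piece 1) (S.piece d)).toLinearMap ∘ₗ
    (LinearMap.rTensor (S.piece d) (φ i))

/-- `S` is connected: the degree-zero component is spanned by the unit, i.e. `R₀ = k`. -/
def ConnectedOne : Prop := S.piece 0 = Submodule.span k {(1 : A)}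

/-- `S` is a *Koszul algebra*: `R₀ = k` and the trivial module `k` admits a linear free
resolution `⋯ → V₂ ⊗ R(-2) → V₁ ⊗ R(-1) → R → k → 0` (this is one of the standard
equivalent definitions of Koszulness: `Extⁿ(k, k(-m)) = 0` for `n ≠ m`).
Exactness is expressed by its graded components: surjectivity of `V₁ ⊗ R_d → R_{d+1}`
(exactness at `R` in positive degrees), injectivity of `V_{i+1} ⊗ R₀ → V_i ⊗ R₁`
(exactness in the lowest degree at each spot), and `range = ker` elsewhere. -/
def IsKoszul : Prop :=
  S.ConnectedOne ∧
  ∃ (n : ℕ → ℕ)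
    (φ : ∀ i : ℕ, (Fin (n (i + 1)) → k) →ₗ[k] ((Fin (n i) → k) ⊗[k] S.piece 1)),
    n 0 = 1 ∧
    (∀ d : ℕ, Surjective (S.Dmap n φ 0 d)) ∧
    (∀ i : ℕ, Injective (S.Dmap n φ i 0)) ∧
    (∀ i d : ℕ, LinearMap.range (S.Dmap n φ (i + 1) d) = LinearMap.ker (S.Dmap n φ i (d + 1)))

/-- `S` is a *quadratic algebra*: `R₀ = k`, `R` is generated by `R₁` and its relations are
generated in degree `2`; equivalently there is an exact sequence
`V₂ ⊗ R(-2) → V₁ ⊗ R(-1) → R → k → 0` (exact at `V₁ ⊗ R(-1)` and at `R`). -/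
def IsQuadratic : Prop :=
  S.ConnectedOne ∧
  ∃ (n : ℕ → ℕ)
    (φ : ∀ i : ℕ, (Fin (n (i + 1)) → k) →ₗ[k] ((Fin (n i) → k) ⊗[k] S.piece 1)),
    n 0 = 1 ∧
    (∀ d : ℕ, Surjective (S.Dmap n φ 0 d)) ∧
    Injective (S.Dmap n φ 0 0) ∧
    (∀ d : ℕ, LinearMap.range (S.Dmap n φ 1 d) = LinearMap.ker (S.Dmap n φ 0 (d + 1)))

end GradedSystem

/-- For `m = 1`, the canonical identification `(k^m) ⊗ M ≃ M`. -/
def oneTensorEquiv {k : Type} [Field k] {m : ℕ} (h : m = 1) (M : Type)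
    [AddCommGroup M] [Module k M] : ((Fin m → k) ⊗[k] M) ≃ₗ[k] M :=
  (TensorProduct.congr
      ((LinearEquiv.funCongrLeft k k (finCongr h.symm)).trans
        (LinearEquiv.funUnique (Fin 1) k k))
      (LinearEquiv.refl k M)).trans (TensorProduct.lid k M)


/-!  ### Smooth connected projective complex curves

A smooth connected projective curve over `ℂ` is (equivalently) presented through its
function field `F` — a finitely generated extension of `ℂ` of transcendence degree 1 —
together with its set of points (= places of `F/ℂ`), each point giving an
order-of-vanishing valuation `ord P : F → ℤ`.  Divisors are finitely supported `ℤ`-valued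
functions on points, and `H⁰(C, O(D))` is the Riemann–Roch space of `D`. -/
structure PreCurve where
  /-- the function field of the curve -/
  F : Type
  [fieldF : Field F]
  [algF : Algebra ℂ F]
  /-- `F` is a finitely generated extension of `ℂ` of transcendence degree 1 -/
  trdeg_one : ∃ x : F, Transcendental ℂ x ∧
    FiniteDimensional (IntermediateField.adjoin ℂ {x}) F
  /-- the (closed) points of the curve -/
  Point : Type
  /-- order of vanishing of a rational function at a point -/
  ord : Point → F → ℤ
  ord_zero' : ∀ P, ord P 0 = 0
  ord_mul : ∀ P, ∀ f g : F, f ≠ 0 → g ≠ 0 → ord P (f * g) = ord P f + ord P g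
  ord_add : ∀ P, ∀ f g : F, f ≠ 0 → g ≠ 0 → f + g ≠ 0 →
    min (ord P f) (ord P g) ≤ ord P (f + g)
  ord_algebraMap : ∀ P, ∀ c : ℂ, c ≠ 0 → ord P (algebraMap ℂ F c) = 0
  /-- every point admits a local uniformizer (the valuation is surjective) -/
  ord_uniformizer : ∀ P, ∃ f : F, f ≠ 0 ∧ ord P f = 1
  /-- a nonzero rational function has only finitely many zeros and poles -/
  ord_finite_support : ∀ f : F, f ≠ 0 → (Function.support fun P => ord P f).Finite
  /-- distinct points are separated by rational functions -/
  ord_separates : ∀ P Q : Point, P ≠ Q → ∃ f : F, f ≠ 0 ∧ 0 < ord P f ∧ ord Q f = 0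

attribute [instance] PreCurve.fieldF PreCurve.algF

namespace PreCurve

variable (C : PreCurve)

/-- Divisors on the curve. -/
abbrev Div := C.Point →₀ ℤ

/-- The divisor of a single point. -/
def pt (P : C.Point) : C.Div := Finsupp.single P 1

/-- The degree of a divisor. -/
def deg (D : C.Div) : ℤ := D.sum fun _ n => n

/-- The Riemann–Roch space `H⁰(C, O(D)) = {f ∈ F | div f + D ≥ 0} ∪ {0}`. -/
def H0 (D : C.Div) : Submodule ℂ C.F where
  carrier := {f : C.F | f = 0 ∨ ∀ P, 0 ≤ C.ord P f + D P}
  zero_mem' := Or.inl rfl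
  add_mem' := by
    intro f g hf hg
    rcases eq_or_ne f 0 with rfl | hf0
    · simpa using hg
    rcases eq_or_ne g 0 with rfl | hg0
    · simpa using hf
    rcases eq_or_ne (f + g) 0 with h0 | h0
    · exact Or.inl h0
    rcases hf with rfl | hf
    · exact absurd rfl hf0
    rcases hg with rfl | hg
    · exact absurd rfl hg0
    refine Or.inr fun P => ?_
    have hmin := C.ord_add P f g hf0 hg0 h0
    rcases le_total (C.ord P f) (C.ord P g) with hle | hle
    · rw [min_eq_left hle] at hmin
      have := hf P; omega
    · rw [min_eq_right hle] at hmin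
      have := hg P; omega
  smul_mem' := by
    intro c f hf
    rcases eq_or_ne c 0 with rfl | hc
    · exact Or.inl (zero_smul ℂ f)
    rcases hf with rfl | hf
    · exact Or.inl (smul_zero c)
    rcases eq_or_ne f 0 with rfl | hf0
    · exact Or.inl (smul_zero c)
    refine Or.inr fun P => ?_
    have hmap : (algebraMap ℂ C.F c) ≠ 0 := fun h =>
      hc ((algebraMap ℂ C.F).injective (by rw [h, map_zero]))
    have hsm : c • f = algebraMap ℂ C.F c * f := Algebra.smul_def c f
    rw [hsm, C.ord_mul P _ f hmap hf0, C.ord_algebraMap P c hc]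
    simpa using hf P

theorem mem_H0 {D : C.Div} {f : C.F} :
    f ∈ C.H0 D ↔ (f = 0 ∨ ∀ P, 0 ≤ C.ord P f + D P) := Iff.rfl

/-- `h⁰(D) = dim H⁰(C, O(D))`. -/
def h0 (D : C.Div) : ℕ := Module.finrank ℂ (C.H0 D)

theorem H0_mono {D E : C.Div} (h : ∀ P, D P ≤ E P) : C.H0 D ≤ C.H0 E := by
  intro f hf
  rcases (C.mem_H0.mp hf) with rfl | hf
  · exact (C.H0 E).zero_mem
  · exact C.mem_H0.mpr (Or.inr fun P => by have := h P; have := hf P; omega)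

theorem mul_mem_H0 {D E : C.Div} {f g : C.F} (hf : f ∈ C.H0 D) (hg : g ∈ C.H0 E) :
    f * g ∈ C.H0 (D + E) := by
  rcases (C.mem_H0.mp hf) with rfl | hf
  · exact C.mem_H0.mpr (Or.inl (zero_mul g))
  rcases (C.mem_H0.mp hg) with rfl | hg
  · exact C.mem_H0.mpr (Or.inl (mul_zero f))
  rcases eq_or_ne f 0 with rfl | hf0
  · exact C.mem_H0.mpr (Or.inl (zero_mul g))
  rcases eq_or_ne g 0 with rfl | hg0
  · exact C.mem_H0.mpr (Or.inl (mul_zero f))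
  refine C.mem_H0.mpr (Or.inr fun P => ?_)
  rw [C.ord_mul P f g hf0 hg0, Finsupp.add_apply]
  have := hf P; have := hg P; omega

/-- Multiplication of sections, `H⁰(D) ⊗ H⁰(E) → H⁰(D + E)`, as a bilinear map. -/
def mulH0 (D E : C.Div) : C.H0 D →ₗ[ℂ] C.H0 E →ₗ[ℂ] C.H0 (D + E) :=
  LinearMap.mk₂ ℂ (fun f g => ⟨(f : C.F) * (g : C.F), C.mul_mem_H0 f.2 g.2⟩)
    (fun f f' g => Subtype.ext (by simp [add_mul]))
    (fun c f g => Subtype.ext (by simp [smul_mul_assoc]))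
    (fun f g g' => Subtype.ext (by simp [mul_add]))
    (fun c f g => Subtype.ext (by simp [mul_smul_comm]))

/-- Transport of `H⁰` along an equality of divisors. -/
def castH0 {D E : C.Div} (h : D = E) : (C.H0 D : Type) ≃ₗ[ℂ] C.H0 E :=
  LinearEquiv.ofEq _ _ (by rw [h])

/-- The multiplication map `H⁰(D) ⊗ H⁰(E) → H⁰(G)` for `G = D + E`. -/
def mulTo (D E G : C.Div) (h : D + E = G) : (C.H0 D ⊗[ℂ] C.H0 E) →ₗ[ℂ] C.H0 G :=
  (C.castH0 h).toLinearMap ∘ₗ TensorProduct.lift (C.mulH0 D E)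

/-- The inclusion `H⁰(D) ⊆ H⁰(E)` for `D ≤ E`. -/
def inclH0 {D E : C.Div} (h : ∀ P, D P ≤ E P) : (C.H0 D : Type) →ₗ[ℂ] C.H0 E :=
  Submodule.inclusion (C.H0_mono h)

/-- Multiplication by a fixed section `a ∈ H⁰(E)`, as a map `H⁰(M) → H⁰(E + M)`. -/
def mulBy {E : C.Div} (a : C.F) (ha : a ∈ C.H0 E) (M : C.Div) :
    (C.H0 M : Type) →ₗ[ℂ] C.H0 (E + M) :=
  C.mulH0 E M ⟨a, ha⟩

/-- The reduced effective divisor attached to a finite set of points. -/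
def divOfFinset (s : Finset C.Point) : C.Div := ∑ P ∈ s, C.pt P

/-- The divisor of a nonzero rational function. -/
def divOf (f : C.F) : C.Div := by
  classical
  exact if h : f = 0 then 0
    else Finsupp.ofSupportFinite (fun P => C.ord P f) (C.ord_finite_support f h)

/-- Linear equivalence of divisors. -/
def LinEquiv (D E : C.Div) : Prop := ∃ f : C.F, f ≠ 0 ∧ D - E = C.divOf f

end PreCurve

/-- A smooth connected projective complex curve: the data of `PreCurve` together with
properness (principal divisors have degree zero), finite–dimensionality of Riemann–Roch
spaces, `H⁰(O) = ℂ`, a canonical divisor `K`, and the genus, tied together by the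
Riemann–Roch theorem (in its Serre-duality form `h⁰(D) − h⁰(K−D) = deg D + 1 − g`). -/
structure Curve extends PreCurve where
  deg_principal : ∀ f : toPreCurve.F, f ≠ 0 → (∑ᶠ P, toPreCurve.ord P f) = 0
  finiteDim : ∀ D : toPreCurve.Div, FiniteDimensional ℂ (toPreCurve.H0 D)
  h0_triv : toPreCurve.h0 0 = 1
  /-- a canonical divisor (class) of the curve -/
  K : toPreCurve.Div
  /-- the genus of the curve -/
  genus : ℕ
  riemann_roch : ∀ D : toPreCurve.Div,
    (toPreCurve.h0 D : ℤ) - toPreCurve.h0 (K - D) = toPreCurve.deg D + 1 - genus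

namespace Curve

variable (C : Curve)

/-- `h¹(D)`, via Serre duality. -/
def h1 (D : C.Div) : ℕ := C.h0 (C.K - D)

/-- The complete linear system `|D|` is base-point free. -/
def BasePointFree (D : C.Div) : Prop := ∀ P : C.Point, C.h0 (D - C.pt P) + 1 = C.h0 D

/-- `|D|` is a base-point-free pencil (base-point free of projective dimension 1). -/
def IsBPFPencil (D : C.Div) : Prop := C.BasePointFree D ∧ C.h0 D = 2

/-- `C` is hyperelliptic: it carries a `g¹₂`. -/
def Hyperelliptic : Prop := ∃ D : C.Div, C.deg D = 2 ∧ 2 ≤ C.h0 D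

/-- `C` is trigonal: it admits a degree-3 map to `ℙ¹`. -/
def Trigonal : Prop := ∃ D : C.Div, C.deg D = 3 ∧ 2 ≤ C.h0 D ∧ C.BasePointFree D

/-- `D` is very ample (it separates points and tangent vectors). -/
def VeryAmple (D : C.Div) : Prop :=
  ∀ P Q : C.Point, C.h0 (D - C.pt P - C.pt Q) + 2 = C.h0 D

/-- `C` is a smooth plane quintic: it carries a very ample `g²₅`. -/
def IsPlaneQuintic : Prop := ∃ D : C.Div, C.deg D = 5 ∧ C.h0 D = 3 ∧ C.VeryAmple D

/-- The homogeneous coordinate algebra `R_L = ⊕ₙ H⁰(C, Lⁿ)` of a divisor (class) `L`,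
as a graded system inside the function field. -/
def RL (L : C.Div) : GradedSystem ℂ C.F where
  piece n := C.H0 (n • L)
  one_mem := by
    refine C.mem_H0.mpr (Or.inr fun P => ?_)
    have h1 : C.ord P 1 = 0 := by
      simpa using C.ord_algebraMap P 1 one_ne_zero
    simp [h1]
  mul_mem := by
    intro m n x y hx hy
    have h := C.mul_mem_H0 hx hy
    show x * y ∈ C.H0 ((m + n) • L)
    rwa [add_smul]

/-- The embedding given by the complete linear system `|L|` is projectively normal:
`R_L` is generated in degree one (equivalently, `Symⁿ H⁰(L) → H⁰(Lⁿ)` is surjective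
for all `n`). -/
def ProjectivelyNormal (L : C.Div) : Prop :=
  ∀ n : ℕ, Surjective
    (C.mulTo L (n • L) ((n + 1) • L) ((add_comm L (n • L)).trans (succ_nsmul L n).symm))

end Curve

/-- The homology of a (two-step) complex `X → Y → Z` at `Y`. -/
def homol {X Y Z : Type} [AddCommGroup X] [AddCommGroup Y] [AddCommGroup Z]
    [Module ℂ X] [Module ℂ Y] [Module ℂ Z] (f : X →ₗ[ℂ] Y) (g : Y →ₗ[ℂ] Z) : Type :=
  ↥(LinearMap.ker g) ⧸ Submodule.comap (LinearMap.ker g).subtype (LinearMap.range f)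


/-!  ### Tetragonal curves on rational normal scrolls

A base-point-free tetragonal system `T` on a non-hyperelliptic curve `C` of genus `g`
embeds `C` (canonically) into the 3-dimensional rational normal scroll
`X = P(V^∨) → ℙ¹`, where `V = O(e 0) ⊕ O(e 1) ⊕ O(e 2)` is the rank-3 bundle on `ℙ¹`
defined as the kernel of the relative-duality surjection `π_* K_C → O(-2)`
(so `h⁰(V(-m)) = h⁰(K_C - mT)`).
We encode such a presentation concretely inside the function field of `C`:
`x` is an affine coordinate of the tetragonal pencil and `w i ∈ H⁰(K - (e i)·T)` is a
generating section of the `i`-th summand of `V`; the sections of `O_X(n)(-mH)` are then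
the polynomials in `x, w 0, w 1, w 2` of degree `n` in the `w`'s whose coefficient in
`x` is suitably bounded (the "admissible" polynomials below), and restriction to `C` is
evaluation in the function field. -/

/-- A monomial in the variables `X = var 0, W i = var i.succ` is admissible of bidegree
`(n, m)` (a monomial section of `O_X(n)(-mH)`) if it has degree `n` in the `W`'s and its
`X`-degree `k` satisfies `k + m ≤ ∑ (deg_{W i}) * e i`. -/
def admissible (e : Fin 3 → ℤ) (n : ℕ) (m : ℤ) (μ : Fin 4 →₀ ℕ) : Prop :=
  (∑ i : Fin 3, μ i.succ) = n ∧ ((μ 0 : ℤ) + m ≤ ∑ i : Fin 3, (μ i.succ : ℤ) * e i)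

/-- The space `H⁰(X, O_X(n)(-mH))` of sections of bidegree `(n,m)` on the scroll,
realized as the admissible polynomials in `ℂ[X, W 0, W 1, W 2]`. -/
def AdmSub (e : Fin 3 → ℤ) (n : ℕ) (m : ℤ) : Submodule ℂ (MvPolynomial (Fin 4) ℂ) where
  carrier := {p | ∀ μ ∈ p.support, admissible e n m μ}
  zero_mem' := by intro μ hμ; simp at hμ
  add_mem' := by
    intro p q hp hq μ hμ
    rcases Finset.mem_union.mp (MvPolynomial.support_add hμ) with h | h
    · exact hp μ h
    · exact hq μ h
  smul_mem' := by
    intro c p hp μ hμ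
    exact hp μ (MvPolynomial.support_smul hμ)

namespace Curve

variable (C : Curve)

/-- Substitution of the scroll coordinates: `X ↦ x`, `W i ↦ w i`. -/
def scrollVars (x : C.F) (w : Fin 3 → C.F) : Fin 4 → C.F := fun j => Fin.cases x w j

/-- Restriction of polynomial sections on the scroll to the curve: evaluation in the
function field. -/
def scrollEval (x : C.F) (w : Fin 3 → C.F) : MvPolynomial (Fin 4) ℂ →ₗ[ℂ] C.F :=
  (MvPolynomial.aeval (C.scrollVars x w)).toLinearMap

end Curve

/-- A presentation of the pair `(C, T)` (tetragonal curve with base-point-free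
tetragonal system, represented by an effective divisor `T`) on the rational normal
scroll of splitting type `e`. -/
structure ScrollData (C : Curve) (T : C.Div) (e : Fin 3 → ℤ) where
  /-- affine coordinate of the tetragonal pencil -/
  x : C.F
  /-- generating sections of the three line-bundle summands of `V ⊆ π_* K_C` -/
  w : Fin 3 → C.F
  /-- `{1, x}` spans the tetragonal pencil `H⁰(T)` -/
  pencil_span : Submodule.span ℂ {1, x} = C.H0 T
  /-- the `w i` are linearly independent over `ℂ[x]` (i.e. `V = ⊕ O(e i)` is a
  subsheaf of `π_* K_C`) -/
  indep : LinearIndependent ℂ (fun q : Fin 3 × ℕ => x ^ q.2 * w q.1)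
  /-- for every `m ≥ 0` the monomial sections `x^j * w i` with `j ≤ e i − m` span
  `H⁰(K − mT)`: this encodes `h⁰(V(−m)) = h⁰(K_C − mT)` together with the splitting
  type of `V` -/
  span_KmT : ∀ m : ℕ,
    Submodule.span ℂ
        {f : C.F | ∃ (i : Fin 3) (j : ℕ), (j : ℤ) ≤ e i - m ∧ f = x ^ j * w i} =
      C.H0 (C.K - m • T)

/-- `C` is the complete intersection of the divisors `S₁ = {Q₁ = 0} ∈ |O_X(2)(-aH)|`
and `S₂ = {Q₂ = 0} ∈ |O_X(2)(-bH)|` on the scroll: both quadrics vanish on `C` and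
together they generate the (bigraded) ideal of `C` on the scroll. -/
def ScrollData.CI {C : Curve} {T : C.Div} {e : Fin 3 → ℤ} (sd : ScrollData C T e)
    (a b : ℤ) (Q₁ Q₂ : MvPolynomial (Fin 4) ℂ) : Prop :=
  Q₁ ∈ AdmSub e 2 a ∧ Q₂ ∈ AdmSub e 2 b ∧
  C.scrollEval sd.x sd.w Q₁ = 0 ∧ C.scrollEval sd.x sd.w Q₂ = 0 ∧
  ∀ (n : ℕ) (m : ℤ), m ≤ 0 →
    AdmSub e (n + 2) m ⊓ LinearMap.ker (C.scrollEval sd.x sd.w) =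
      Submodule.map (LinearMap.mulLeft ℂ Q₁) (AdmSub e n (m - a)) ⊔
        Submodule.map (LinearMap.mulLeft ℂ Q₂) (AdmSub e n (m - b))

/-- The kernel of the restriction `H⁰(X, O_X(2)(-mH)) = H⁰(ℙ¹, S²V(-m)) → H⁰(C, 2K - mT)`,
i.e. `H⁰(ℙ¹, E(-m))` where `E = ker (S²V → π_*(K_C²))`. -/
def quadKer (C : Curve) {T : C.Div} {e : Fin 3 → ℤ} (sd : ScrollData C T e) (m : ℤ) :
    Submodule ℂ (MvPolynomial (Fin 4) ℂ) :=
  AdmSub e 2 m ⊓ LinearMap.ker (C.scrollEval sd.x sd.w)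

section

namespace GradedSystem

variable {k A : Type} [Field k] [Ring A] [Algebra k A] (S : GradedSystem k A)

/-- The multiplication map `R₁ ⊗ R_d → R_{d+1}`. -/
def linMul (d : ℕ) : (S.piece 1 ⊗[k] S.piece d) →ₗ[k] S.piece (d + 1) :=
  (S.cast (add_comm 1 d)).toLinearMap ∘ₗ TensorProduct.lift (S.mulMap 1 d)

@[simp] theorem linMul_tmul (d : ℕ) (x : S.piece 1) (y : S.piece d) :
    (S.linMul d (x ⊗ₜ y) : A) = (x : A) * (y : A) := rfl

/-- Right multiplication `(V ⊗ R₁) ⊗ R_d → V ⊗ R_{d+1}` on the free module with generators `V`. -/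
def freeMul (V : Type) [AddCommGroup V] [Module k V] (d : ℕ) :
    ((V ⊗[k] S.piece 1) ⊗[k] S.piece d) →ₗ[k] (V ⊗[k] S.piece (d + 1)) :=
  (LinearMap.lTensor V (S.linMul d)) ∘ₗ
    (TensorProduct.assoc k V (S.piece 1) (S.piece d)).toLinearMap

@[simp] theorem freeMul_tmul (V : Type) [AddCommGroup V] [Module k V] (d : ℕ)
    (v : V) (x : S.piece 1) (y : S.piece d) :
    S.freeMul V d ((v ⊗ₜ x) ⊗ₜ y) = v ⊗ₜ S.linMul d (x ⊗ₜ y) := rfl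

theorem Dmap_tmul (n : ℕ → ℕ)
    (φ : ∀ i : ℕ, (Fin (n (i + 1)) → k) →ₗ[k] ((Fin (n i) → k) ⊗[k] S.piece 1))
    (i d : ℕ) (v : Fin (n (i + 1)) → k) (r : S.piece d) :
    S.Dmap n φ i d (v ⊗ₜ r) = S.freeMul _ d (φ i v ⊗ₜ r) := rfl

/-- The ranks of the free modules in a linear presentation with `n` quadratic relations. -/
def presRank (S : GradedSystem k A) (n : ℕ) : ℕ → ℕ
  | 0 => 1
  | 1 => Module.finrank k (S.piece 1)
  | 2 => n
  | _ => 0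

theorem exists_equiv_ker {k V W : Type} [Field k] [AddCommGroup V] [Module k V]
    [AddCommGroup W] [Module k W] [FiniteDimensional k V] (f : V →ₗ[k] W) :
    ∃ n : ℕ, Nonempty ((Fin n → k) ≃ₗ[k] LinearMap.ker f) :=
  ⟨_, ⟨(Module.finBasis k (LinearMap.ker f)).equivFun.symm⟩⟩

theorem isQuadratic_of [FiniteDimensional k (S.piece 1)] (h0 : S.ConnectedOne)
    (hgen : ∀ d, Surjective (S.linMul d))
    (hrel : ∀ d, ∀ z ∈ LinearMap.ker (S.linMul (d + 1)),
      z ∈ Submodule.span k {y | ∃ t ∈ LinearMap.ker (S.linMul 1), ∃ r : S.piece d,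
        y = S.freeMul (S.piece 1) d (t ⊗ₜ r)}) : S.IsQuadratic := by
  classical
  obtain ⟨n, ⟨γ⟩⟩ := exists_equiv_ker (k := k) (V := S.piece 1 ⊗[k] S.piece 1)
    (W := S.piece (1 + 1)) (S.linMul 1)
  let β : (Fin (presRank S n 1) → k) ≃ₗ[k] S.piece 1 :=
    (Module.finBasis k (S.piece 1)).equivFun.symm
  let u : Fin (presRank S n 0) → k := fun _ => 1
  let φ0 : (Fin (presRank S n 1) → k) →ₗ[k] ((Fin (presRank S n 0) → k) ⊗[k] S.piece 1) :=
    (TensorProduct.mk k (Fin (presRank S n 0) → k) (S.piece 1) u) ∘ₗ β.toLinearMap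
  let φ1 : (Fin (presRank S n 2) → k) →ₗ[k] ((Fin (presRank S n 1) → k) ⊗[k] S.piece 1) :=
    (LinearMap.rTensor (S.piece 1) β.symm.toLinearMap) ∘ₗ
      (LinearMap.ker (S.linMul 1)).subtype ∘ₗ γ.toLinearMap
  let φ : ∀ i : ℕ, (Fin (presRank S n (i + 1)) → k) →ₗ[k]
      ((Fin (presRank S n i) → k) ⊗[k] S.piece 1) := fun i =>
    match i with
    | 0 => φ0
    | 1 => φ1
    | _ + 2 => 0
  have hone : ∀ d (y : S.piece d) , u ⊗ₜ[k] y = 0 → y = 0 := by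
    intro d y hy
    have h := (congrArg (oneTensorEquiv (k := k) (m := 1) rfl (S.piece d)) hy).trans
      (LinearEquiv.map_zero _)
    exact (one_smul k y).symm.trans h
  have hD0 : ∀ d (z : (Fin (presRank S n 1) → k) ⊗[k] S.piece d),
      S.Dmap (presRank S n) φ 0 d z = u ⊗ₜ S.linMul d (LinearMap.rTensor _ β.toLinearMap z) := by
    intro d z
    induction z with
    | zero => simp
    | add x y hx hy => simp only [map_add, hx, hy, TensorProduct.tmul_add]
    | tmul v r => rw [Dmap_tmul]; rfl
  have hD1 : ∀ d (v) (r : S.piece d),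
      LinearMap.rTensor _ β.toLinearMap (S.Dmap (presRank S n) φ 1 d (v ⊗ₜ r)) =
        S.freeMul _ d ((γ v : S.piece 1 ⊗[k] S.piece 1) ⊗ₜ r) := by
    intro d v r
    rw [Dmap_tmul]
    change LinearMap.rTensor _ β.toLinearMap (S.freeMul _ d
      (LinearMap.rTensor (S.piece 1) β.symm.toLinearMap
        (γ v : S.piece 1 ⊗[k] S.piece 1) ⊗ₜ r)) = _
    generalize (γ v : S.piece 1 ⊗[k] S.piece 1) = t
    induction t with
    | zero => simp
    | add x y hx hy => simp only [map_add, hx, hy, TensorProduct.add_tmul]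
    | tmul v r => simp
  have hβ : ∀ d, Bijective (LinearMap.rTensor (S.piece d) β.toLinearMap) := fun d =>
    (LinearEquiv.rTensor (S.piece d) β).bijective
  have hk : ∀ d (z : (Fin (presRank S n 1) → k) ⊗[k] S.piece d),
      S.Dmap (presRank S n) φ 0 d z = 0 ↔ S.linMul d (LinearMap.rTensor _ β.toLinearMap z) = 0 := by
    intro d z
    rw [hD0]
    refine ⟨hone _ _, fun h => by rw [h, TensorProduct.tmul_zero]⟩
  have h0mem : ∀ r : S.piece 0, ∃ c : k, (r : A) = c • 1 := by
    intro r
    obtain ⟨c, hc⟩ := Submodule.mem_span_singleton.mp (h0.le r.2)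
    exact ⟨c, hc.symm⟩
  refine ⟨h0, presRank S n, φ, rfl, ?_, ?_, ?_⟩
  · intro d y
    obtain ⟨y', hy'⟩ : ∃ y', y = u ⊗ₜ y' := by
      induction y with
      | zero => exact ⟨0, by simp⟩
      | add x y hx hy =>
        obtain ⟨x', rfl⟩ := hx
        obtain ⟨y', rfl⟩ := hy
        exact ⟨x' + y', by rw [TensorProduct.tmul_add]⟩
      | tmul v r =>
        refine ⟨v (0 : Fin 1) • r, ?_⟩
        rw [← TensorProduct.smul_tmul]
        congr 1
        ext j
        have : j = (0 : Fin 1) := Subsingleton.elim (α := Fin 1) _ _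
        subst this
        exact (mul_one _).symm
    obtain ⟨z, hz⟩ := hgen d y'
    obtain ⟨z', rfl⟩ := (hβ d).2 z
    exact ⟨z', by rw [hD0, hz, hy']⟩
  · rw [injective_iff_map_eq_zero]
    intro z hz
    rw [hk] at hz
    apply (hβ 0).1
    rw [map_zero]
    generalize LinearMap.rTensor _ β.toLinearMap z = y at hz
    obtain ⟨s, rfl⟩ : ∃ s : S.piece 1, y = s ⊗ₜ ⟨1, S.one_mem⟩ := by
      clear hz
      induction y with
      | zero => exact ⟨0, by simp⟩
      | add x y hx hy =>
        obtain ⟨x', rfl⟩ := hx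
        obtain ⟨y', rfl⟩ := hy
        exact ⟨x' + y', by rw [TensorProduct.add_tmul]⟩
      | tmul v r =>
        obtain ⟨c, hc⟩ := h0mem r
        refine ⟨c • v, ?_⟩
        rw [TensorProduct.smul_tmul]
        congr 1
        exact Subtype.ext hc
    have := congrArg Subtype.val hz
    rw [linMul_tmul] at this
    have hs : s = 0 := Subtype.ext (by simpa using this)
    rw [hs, TensorProduct.zero_tmul]
  · intro d
    apply le_antisymm
    · rintro _ ⟨z, rfl⟩
      rw [LinearMap.mem_ker, hk]
      induction z with
      | zero => simp
      | add x y hx hy => simp only [map_add, hx, hy, add_zero]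
      | tmul v r =>
        rw [hD1]
        have key : ∀ t : S.piece 1 ⊗[k] S.piece 1,
            (S.linMul (d + 1) (S.freeMul (S.piece 1) d (t ⊗ₜ r)) : A) =
              (S.linMul 1 t : A) * (r : A) := by
          intro t
          induction t with
          | zero => simp
          | add x y hx hy => simp only [map_add, TensorProduct.add_tmul, Submodule.coe_add,
              hx, hy, add_mul]
          | tmul v r => simp [mul_assoc]
        apply Subtype.ext
        have h2 : S.linMul 1 (γ v : S.piece 1 ⊗[k] S.piece 1) = 0 := (γ v).2
        rw [key, h2]
        simp
    · intro z hz
      rw [LinearMap.mem_ker, hk] at hz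
      have := hrel d _ hz
      suffices hs : ∀ y ∈ Submodule.span k {y | ∃ t ∈ LinearMap.ker (S.linMul 1),
          ∃ r : S.piece d, y = S.freeMul (S.piece 1) d (t ⊗ₜ r)},
          ∃ x, LinearMap.rTensor _ β.toLinearMap (S.Dmap (presRank S n) φ 1 d x) = y by
        obtain ⟨x, hx⟩ := hs _ this
        exact ⟨x, (hβ _).1 hx⟩
      intro y hy
      induction hy using Submodule.span_induction with
      | zero => exact ⟨0, by simp⟩
      | add x y _ _ hx hy =>
        obtain ⟨x', rfl⟩ := hx
        obtain ⟨y', rfl⟩ := hy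
        exact ⟨x' + y', by simp only [map_add]⟩
      | smul c x _ hx =>
        obtain ⟨x', rfl⟩ := hx
        exact ⟨c • x', by simp only [map_smul]⟩
      | mem y hy =>
        obtain ⟨t, ht, r, rfl⟩ := hy
        refine ⟨γ.symm ⟨t, ht⟩ ⊗ₜ r, ?_⟩
        refine (hD1 d _ r).trans ?_
        rw [LinearEquiv.apply_symm_apply]

variable {S}

theorem IsQuadratic.linMul_surjective (h : S.IsQuadratic) (d : ℕ) : Surjective (S.linMul d) := by
  obtain ⟨-, n, φ, hn, hs, -, -⟩ := h
  have h1 : Surjective (LinearMap.lTensor (Fin (n 0) → k) (S.linMul d)) := by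
    intro y
    obtain ⟨z, hz⟩ := hs d y
    exact ⟨_, hz⟩
  intro y
  obtain ⟨z, hz⟩ := h1 ((oneTensorEquiv hn _).symm y)
  refine ⟨oneTensorEquiv hn _ z, ?_⟩
  rw [← LinearEquiv.apply_symm_apply (oneTensorEquiv (k := k) hn (S.piece (d + 1))) y, ← hz]
  clear hz
  induction z with
  | zero => simp
  | add x y hx hy => simp only [map_add, hx, hy]
  | tmul v r => simp [oneTensorEquiv]

/-- In a quadratic algebra the linear syzygies of `R₁ ⊗ R_{d+1} → R_{d+2}` are generated by
`ker (R₁ ⊗ R₁ → R₂)`. -/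
theorem IsQuadratic.ker_linMul_le (h : S.IsQuadratic) (d : ℕ) :
    LinearMap.ker (S.linMul (d + 1)) ≤
      Submodule.span k {y | ∃ t ∈ LinearMap.ker (S.linMul 1), ∃ r : S.piece d,
        y = S.freeMul (S.piece 1) d (t ⊗ₜ r)} := by
  obtain ⟨h0, n, φ, hn, hs, hi, he⟩ := h
  have hone : (1 : A) ∈ S.piece 0 := S.one_mem
  let β : (Fin (n 1) → k) →ₗ[k] S.piece 1 := (oneTensorEquiv hn _).toLinearMap ∘ₗ φ 0
  have hD0 : ∀ d (z : (Fin (n 1) → k) ⊗[k] S.piece d),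
      oneTensorEquiv hn _ (S.Dmap n φ 0 d z) = S.linMul d (LinearMap.rTensor _ β z) := by
    intro d z
    induction z with
    | zero => simp
    | add x y hx hy => simp only [map_add, hx, hy]
    | tmul v r =>
      rw [Dmap_tmul, LinearMap.rTensor_tmul]
      change _ = S.linMul d (oneTensorEquiv hn _ (φ 0 v) ⊗ₜ r)
      generalize φ 0 v = t
      induction t with
      | zero => simp
      | add x y hx hy => simp only [map_add, hx, hy, TensorProduct.add_tmul]
      | tmul v y =>
        simp only [freeMul_tmul, oneTensorEquiv, LinearEquiv.trans_apply,
          TensorProduct.congr_tmul, TensorProduct.lid_tmul, LinearEquiv.refl_apply]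
        rw [← TensorProduct.smul_tmul', map_smul]
  have hβ : Surjective β := by
    intro y
    obtain ⟨z, hz⟩ := hs 0 ((oneTensorEquiv hn _).symm y)
    have hz' := hD0 0 z
    rw [hz, LinearEquiv.apply_symm_apply] at hz'
    rw [hz']
    clear hz' hz
    induction z with
    | zero => exact ⟨0, by simp⟩
    | add x y hx hy =>
      obtain ⟨x', hx'⟩ := hx
      obtain ⟨y', hy'⟩ := hy
      exact ⟨x' + y', by simp only [map_add, hx', hy']⟩
    | tmul v r =>
      obtain ⟨c, hc⟩ := Submodule.mem_span_singleton.mp (h0.le r.2)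
      refine ⟨c • v, Subtype.ext ?_⟩
      rw [LinearMap.rTensor_tmul, linMul_tmul, ← hc]
      simp
  intro z hz
  obtain ⟨z', rfl⟩ := LinearMap.rTensor_surjective _ hβ z
  rw [LinearMap.mem_ker, ← hD0, LinearEquiv.map_eq_zero_iff, ← LinearMap.mem_ker, ← he] at hz
  obtain ⟨y, rfl⟩ := hz
  induction y with
  | zero => simp
  | add x y hx hy => simp only [map_add]; exact add_mem hx hy
  | tmul v r =>
    refine Submodule.subset_span ⟨LinearMap.rTensor _ β (φ 1 v), ?_, r, ?_⟩
    · rw [LinearMap.mem_ker, ← hD0, LinearEquiv.map_eq_zero_iff, ← LinearMap.mem_ker]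
      change φ 1 v ∈ LinearMap.ker (S.Dmap n φ 0 (0 + 1))
      rw [← he]
      refine ⟨v ⊗ₜ ⟨1, hone⟩, ?_⟩
      rw [Dmap_tmul]
      generalize φ 1 v = t
      induction t with
      | zero => simp
      | add x y hx hy => simp only [map_add, hx, hy, TensorProduct.add_tmul]
      | tmul v r =>
        rw [freeMul_tmul]
        congr 1
        exact Subtype.ext (by simp)
    · rw [Dmap_tmul]
      generalize φ 1 v = t
      induction t with
      | zero => simp
      | add x y hx hy => simp only [map_add, hx, hy, TensorProduct.add_tmul]
      | tmul v r => simp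

end GradedSystem

namespace PreCurve

variable (C : PreCurve)

theorem deg_add (D D' : C.Div) : C.deg (D + D') = C.deg D + C.deg D' :=
  Finsupp.sum_add_index' (fun _ => rfl) fun _ _ _ => rfl

/-- The degree, as a homomorphism. -/
def degHom : C.Div →+ ℤ where
  toFun := C.deg
  map_zero' := Finsupp.sum_zero_index
  map_add' := C.deg_add

theorem deg_zero : C.deg 0 = 0 := C.degHom.map_zero

theorem deg_sub (D D' : C.Div) : C.deg (D - D') = C.deg D - C.deg D' :=
  C.degHom.map_sub D D'

theorem deg_zsmul (n : ℤ) (D : C.Div) : C.deg (n • D) = n * C.deg D := by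
  exact (C.degHom.map_zsmul n D).trans (smul_eq_mul _ _)

theorem deg_eq_finsum (D : C.Div) : C.deg D = ∑ᶠ P, D P := by
  rw [finsum_eq_sum_of_support_subset (s := D.support) _ (by intro P hP; simpa using hP)]
  rfl

end PreCurve

namespace Curve

variable (C : Curve)

instance (D : C.Div) : FiniteDimensional ℂ (C.H0 D) := C.finiteDim D

theorem h0_eq_zero_of_deg_neg {D : C.Div} (hD : C.deg D < 0) : C.h0 D = 0 := by
  have hbot : C.H0 D = ⊥ := by
    rw [eq_bot_iff]
    intro f hf
    by_contra hf0
    rcases C.mem_H0.mp hf with h | h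
    · exact hf0 h
    · have h1 : 0 ≤ ∑ᶠ P, (C.ord P f + D P) := finsum_nonneg h
      rw [finsum_add_distrib (C.ord_finite_support f hf0) D.hasFiniteSupport,
        C.deg_principal f hf0, ← C.deg_eq_finsum] at h1
      omega
  rw [PreCurve.h0, hbot, finrank_bot]

theorem h0_K : C.h0 C.K = C.genus := by
  have h := C.riemann_roch 0
  rw [C.h0_triv, sub_zero, C.deg_zero] at h
  omega

theorem deg_K : C.deg C.K = 2 * C.genus - 2 := by
  have h := C.riemann_roch C.K
  rw [C.h0_K, sub_self, C.h0_triv] at h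
  omega

/-- The divisor `nK - mT`. -/
def twist (T : C.Div) (n m : ℤ) : C.Div := n • C.K - m • T

variable {C} {T : C.Div}

theorem deg_twist (hT : C.deg T = 4) (n m : ℤ) :
    C.deg (C.twist T n m) = n * (2 * C.genus - 2) - 4 * m := by
  rw [twist, C.deg_sub, C.deg_zsmul, C.deg_zsmul, hT, C.deg_K]
  ring

theorem h0_twist (hT : C.deg T = 4) (hg : 6 ≤ C.genus) {n m : ℤ} (hn : 2 ≤ n) (hm : m ≤ n) :
    (C.h0 (C.twist T n m) : ℤ) = n * (2 * C.genus - 2) - 4 * m + 1 - C.genus := by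
  have h := C.riemann_roch (C.twist T n m)
  rw [deg_twist hT, C.h0_eq_zero_of_deg_neg (D := C.K - _)] at h
  · simpa using h
  · rw [C.deg_sub, deg_twist hT, C.deg_K]
    have : (6 : ℤ) ≤ C.genus := by exact_mod_cast hg
    nlinarith

theorem mul_mem_twist {n n' m m' : ℤ} {f f' : C.F} (hf : f ∈ C.H0 (C.twist T n m))
    (hf' : f' ∈ C.H0 (C.twist T n' m')) : f * f' ∈ C.H0 (C.twist T (n + n') (m + m')) := by
  have h := C.mul_mem_H0 hf hf'
  convert h using 2
  simp only [twist]
  module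

end Curve

namespace ScrollData

variable {C : Curve} {T : C.Div} {e : Fin 3 → ℤ}

theorem h0_K_sub (sd : ScrollData C T e) (m : ℕ) : C.h0 (C.K - m • T) = ∑ i, (e i - m + 1).toNat := by
  let v : (Σ i : Fin 3, Fin (e i - m + 1).toNat) → C.F := fun q => sd.x ^ (q.2 : ℕ) * sd.w q.1
  have hv : LinearIndependent ℂ v :=
    sd.indep.comp (fun q : (Σ i : Fin 3, Fin (e i - m + 1).toNat) => (q.1, (q.2 : ℕ))) (by
      rintro ⟨i, j⟩ ⟨i', j'⟩ h
      obtain ⟨rfl, h⟩ := Prod.mk.inj h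
      exact congrArg _ (Fin.ext h))
  have hr : {f : C.F | ∃ (i : Fin 3) (j : ℕ), (j : ℤ) ≤ e i - m ∧ f = sd.x ^ j * sd.w i} =
      Set.range v := by
    ext f
    constructor
    · rintro ⟨i, j, hj, rfl⟩
      exact ⟨⟨i, j, by omega⟩, rfl⟩
    · rintro ⟨⟨i, j⟩, rfl⟩
      exact ⟨i, j, by have := j.2; omega, rfl⟩
  rw [PreCurve.h0, ← sd.span_KmT m, hr, finrank_span_eq_card hv]
  simp

end ScrollData

/-- The standing numerical facts about a tetragonal curve on a scroll. -/
structure ScrollData.Numerics {C : Curve} {T : C.Div} {e : Fin 3 → ℤ} (_ : ScrollData C T e) :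
    Prop where
  deg_T : C.deg T = 4
  eff : ∀ P, 0 ≤ T P
  genus_ge : 6 ≤ C.genus
  one_le : ∀ i, 1 ≤ e i
  sum_e : e 0 + e 1 + e 2 = (C.genus : ℤ) - 3

theorem ScrollData.numerics {C : Curve} {T : C.Div} {e : Fin 3 → ℤ} (sd : ScrollData C T e)
    (hTdeg : C.deg T = 4) (hTh0 : C.h0 T = 2) (hTeff : ∀ P, 0 ≤ T P)
    (h2T : C.h0 (2 • T) = 3) : sd.Numerics := by
  have r1 := C.riemann_roch T
  have r2 := C.riemann_roch (2 • T)
  have d2 : C.deg (2 • T) = 8 := by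
    rw [two_smul, C.deg_add, hTdeg]; norm_num
  have k0 := sd.h0_K_sub 0
  have k1 := sd.h0_K_sub 1
  have k2 := sd.h0_K_sub 2
  rw [one_smul] at k1
  rw [zero_smul, sub_zero, C.h0_K] at k0
  rw [k1, hTdeg, hTh0] at r1
  rw [k2, d2, h2T] at r2
  simp only [Fin.sum_univ_three] at k0 r1 r2
  have h012 : 1 ≤ e 0 ∧ 1 ≤ e 1 ∧ 1 ≤ e 2 := by
    push_cast at *
    omega
  refine ⟨hTdeg, hTeff, by push_cast at *; omega, ?_, by push_cast at *; omega⟩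
  intro i
  fin_cases i
  · exact h012.1
  · exact h012.2.1
  · exact h012.2.2

namespace MvPolynomial

open scoped Pointwise

variable {σ R : Type} [CommSemiring R]

theorem mul_mem_restrictSupport {s t u : Set (σ →₀ ℕ)} (h : ∀ μ ∈ s, ∀ ν ∈ t, μ + ν ∈ u)
    {p q : MvPolynomial σ R} (hp : p ∈ restrictSupport R s) (hq : q ∈ restrictSupport R t) :
    p * q ∈ restrictSupport R u := by
  have h1 : p * q ∈ restrictSupport R (s + t) := by
    rw [restrictSupport_add]
    exact Submodule.mul_mem_mul hp hq
  exact restrictSupport_mono R (Set.add_subset_iff.mpr fun μ hμ ν hν => h μ hμ ν hν) h1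

theorem restrictSupport_union (s t : Set (σ →₀ ℕ)) :
    restrictSupport R (s ∪ t) = restrictSupport R s ⊔ restrictSupport R t := by
  simp only [restrictSupport_eq_span, Set.image_union, Submodule.span_union]

theorem eq_zero_of_mem_restrictSupport_of_disjoint {s t : Set (σ →₀ ℕ)} (h : Disjoint s t)
    {p : MvPolynomial σ R} (hs : p ∈ restrictSupport R s) (ht : p ∈ restrictSupport R t) :
    p = 0 := by
  rw [mem_restrictSupport_iff] at hs ht
  rw [← support_eq_empty, ← Finset.coe_eq_empty, ← Set.subset_empty_iff]
  exact h hs ht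

end MvPolynomial

open MvPolynomial

namespace Scroll

/-- The degree of a monomial in the variables `W`. -/
def wdeg (μ : Fin 4 →₀ ℕ) : ℤ := μ 1 + μ 2 + μ 3

/-- The largest `m` such that the monomial is a section of `O(n)(-mH)` on the scroll. -/
def wt (e : Fin 3 → ℤ) (μ : Fin 4 →₀ ℕ) : ℤ := μ 1 * e 0 + μ 2 * e 1 + μ 3 * e 2 - μ 0

theorem wdeg_add (μ ν : Fin 4 →₀ ℕ) : wdeg (μ + ν) = wdeg μ + wdeg ν := by
  simp only [wdeg, Finsupp.add_apply]
  push_cast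
  ring

theorem wt_add (e : Fin 3 → ℤ) (μ ν : Fin 4 →₀ ℕ) : wt e (μ + ν) = wt e μ + wt e ν := by
  simp only [wt, Finsupp.add_apply]
  push_cast
  ring

theorem wdeg_nonneg (μ : Fin 4 →₀ ℕ) : 0 ≤ wdeg μ := by
  unfold wdeg; positivity

/-- The sections of `O(n)(-mH)` on the scroll, for arbitrary integers `n` and `m`. -/
def Adm (e : Fin 3 → ℤ) (n m : ℤ) : Submodule ℂ (MvPolynomial (Fin 4) ℂ) :=
  restrictSupport ℂ {μ | wdeg μ = n ∧ m ≤ wt e μ}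

/-- The bihomogeneous polynomials of degree `n` and weight exactly `m`. -/
def Bih (e : Fin 3 → ℤ) (n m : ℤ) : Submodule ℂ (MvPolynomial (Fin 4) ℂ) :=
  restrictSupport ℂ {μ | wdeg μ = n ∧ wt e μ = m}

variable {e : Fin 3 → ℤ} {n n' m m' : ℤ} {p q : MvPolynomial (Fin 4) ℂ}

theorem admSub_eq (n : ℕ) (m : ℤ) : AdmSub e n m = Adm e n m := by
  ext p
  change (∀ μ ∈ p.support, _) ↔ _
  rw [Adm, mem_restrictSupport_iff]
  refine forall_congr' fun μ => forall_congr' fun _ => ?_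
  simp only [admissible, Fin.sum_univ_three, Set.mem_ofPred_eq, wdeg, wt]
  change μ 1 + μ 2 + μ 3 = n ∧ _ + _ ≤ (μ 1 : ℤ) * e 0 + μ 2 * e 1 + μ 3 * e 2 ↔ _
  constructor <;> rintro ⟨h1, h2⟩ <;> constructor <;> omega

theorem mul_mem_adm (hp : p ∈ Adm e n m) (hq : q ∈ Adm e n' m') :
    p * q ∈ Adm e (n + n') (m + m') :=
  mul_mem_restrictSupport (by
    rintro μ ⟨h1, h2⟩ ν ⟨h3, h4⟩
    exact ⟨by rw [wdeg_add, h1, h3], by rw [wt_add]; linarith⟩) hp hq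

theorem mul_mem_bih (hp : p ∈ Bih e n m) (hq : q ∈ Bih e n' m') :
    p * q ∈ Bih e (n + n') (m + m') :=
  mul_mem_restrictSupport (by
    rintro μ ⟨h1, h2⟩ ν ⟨h3, h4⟩
    exact ⟨by rw [wdeg_add, h1, h3], by rw [wt_add]; linarith⟩) hp hq

theorem bih_le_adm : Bih e n m ≤ Adm e n m :=
  restrictSupport_mono ℂ fun _ h => ⟨h.1, h.2.ge⟩

theorem adm_anti (h : m ≤ m') : Adm e n m' ≤ Adm e n m :=
  restrictSupport_mono ℂ fun _ hμ => ⟨hμ.1, h.trans hμ.2⟩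

theorem adm_eq_bot_of_neg (h : n < 0) : Adm e n m = ⊥ := by
  rw [eq_bot_iff]
  intro p hp
  refine eq_zero_of_mem_restrictSupport_of_disjoint (t := ∅) disjoint_bot_right hp
    (restrictSupport_mono ℂ ?_ hp)
  rintro μ ⟨h1, -⟩
  have := wdeg_nonneg μ
  omega

theorem exists_top (hp : p ∈ Adm e n m) :
    ∃ q ∈ Bih e n m, ∃ r ∈ Adm e n (m + 1), p = q + r := by
  have h : Adm e n m ≤ Bih e n m ⊔ Adm e n (m + 1) := by
    rw [Adm, Bih, Adm, ← restrictSupport_union]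
    refine restrictSupport_mono ℂ ?_
    rintro μ ⟨h1, h2⟩
    rcases h2.eq_or_lt with h | h
    · exact Or.inl ⟨h1, h.symm⟩
    · exact Or.inr ⟨h1, h⟩
  obtain ⟨q, hq, r, hr, rfl⟩ := Submodule.mem_sup.mp (h hp)
  exact ⟨q, hq, r, hr, rfl⟩

theorem eq_zero_of_mem_bih_adm (hp : p ∈ Bih e n m) (hp' : p ∈ Adm e n (m + 1)) : p = 0 := by
  refine eq_zero_of_mem_restrictSupport_of_disjoint ?_ hp hp'
  rw [Set.disjoint_left]
  rintro μ ⟨-, h1⟩ ⟨-, h2⟩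
  omega

theorem X_pow_mem_bih (k : ℕ) : (X 0 ^ k : MvPolynomial (Fin 4) ℂ) ∈ Bih e 0 (-k) := by
  rw [X_pow_eq_monomial, Bih, monomial_mem_restrictSupport]
  left
  simp [wdeg, wt]

theorem X_pow_mul_mem_bih (k : ℕ) (hp : p ∈ Bih e n m) : X 0 ^ k * p ∈ Bih e n (m - k) := by
  have := mul_mem_bih (X_pow_mem_bih k) hp
  rwa [zero_add, neg_add_eq_sub] at this

theorem X_pow_mul_mem_adm (k : ℕ) (hp : p ∈ Adm e n m) : X 0 ^ k * p ∈ Adm e n (m - k) := by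
  have := mul_mem_adm (bih_le_adm (X_pow_mem_bih k)) hp
  rwa [zero_add, neg_add_eq_sub] at this

theorem wdeg_le_of_one_le (he : ∀ i, 1 ≤ e i) (μ : Fin 4 →₀ ℕ) : wdeg μ ≤ wt e μ + μ 0 := by
  have h0 := he 0
  have h1 := he 1
  have h2 := he 2
  simp only [wdeg, wt]
  nlinarith [(Int.natCast_nonneg (μ 1)), (Int.natCast_nonneg (μ 2)), (Int.natCast_nonneg (μ 3))]

theorem sub_single_zero_add {μ : Fin 4 →₀ ℕ} {k : ℕ} (h : k ≤ μ 0) :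
    Finsupp.single 0 k + (μ - Finsupp.single 0 k) = μ :=
  add_tsub_cancel_of_le (by simpa using h)

theorem exists_eq_X_pow_mul (he : ∀ i, 1 ≤ e i) (k : ℕ) (hmn : m ≤ n)
    (hp : p ∈ Bih e n (m - k)) : ∃ q ∈ Bih e n m, p = X 0 ^ k * q := by
  have h : Bih e n (m - k) ≤ (Bih e n m).map (LinearMap.mulLeft ℂ (X 0 ^ k)) := by
    conv_lhs => rw [Bih, restrictSupport_eq_span]
    rw [Submodule.span_le]
    rintro _ ⟨μ, ⟨h1, h2⟩, rfl⟩
    have h3 := wdeg_le_of_one_le he μ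
    have hk : k ≤ μ 0 := by omega
    have hμ := sub_single_zero_add hk
    refine ⟨monomial (μ - Finsupp.single 0 k) 1, ?_, ?_⟩
    · change _ ∈ Bih e n m
      rw [Bih, monomial_mem_restrictSupport]
      left
      have hd := wdeg_add (Finsupp.single 0 k) (μ - Finsupp.single 0 k)
      have hw := wt_add e (Finsupp.single 0 k) (μ - Finsupp.single 0 k)
      rw [hμ] at hd hw
      have hd0 : wdeg (Finsupp.single 0 k) = 0 := by simp [wdeg]
      have hw0 : wt e (Finsupp.single 0 k) = -k := by simp [wt]
      constructor <;> omega
    · rw [LinearMap.mulLeft_apply, X_pow_eq_monomial, monomial_mul, hμ, one_mul]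
  obtain ⟨q, hq, rfl⟩ := h hp
  exact ⟨q, hq, rfl⟩

/-! ### Counting sections -/

theorem encard_eq_add_shift (A : Set (Fin 4 →₀ ℕ)) (t : Fin 4) :
    A.encard = {μ | μ ∈ A ∧ μ t = 0}.encard + {μ | μ + Finsupp.single t 1 ∈ A}.encard := by
  have h : A = {μ | μ ∈ A ∧ μ t = 0} ∪
      (fun μ => μ + Finsupp.single t 1) '' {μ | μ + Finsupp.single t 1 ∈ A} := by
    ext μ
    constructor
    · intro hμ
      rcases Nat.eq_zero_or_pos (μ t) with h | h
      · exact Or.inl ⟨hμ, h⟩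
      · have h' : μ - Finsupp.single t 1 + Finsupp.single t 1 = μ :=
          tsub_add_cancel_of_le (by simpa using Nat.succ_le_of_lt h)
        exact Or.inr ⟨μ - Finsupp.single t 1, by rwa [Set.mem_ofPred_eq, h'], h'⟩
    · rintro (h | ⟨ν, hν, rfl⟩)
      · exact h.1
      · exact hν
  conv_lhs => rw [h]
  rw [Set.encard_union_eq, (add_left_injective _).encard_image]
  rw [Set.disjoint_left]
  rintro _ ⟨-, h1⟩ ⟨ν, -, rfl⟩
  simp at h1

theorem encard_sections_one (he : ∀ i, 1 ≤ e i) (n : ℕ) (m : ℤ) (hm : m ≤ n + 1) :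
    ∃ c : ℕ, {μ | ((wdeg μ = n ∧ m ≤ wt e μ) ∧ μ 1 = 0) ∧ μ 2 = 0}.encard = c ∧
      (c : ℤ) = n * e 2 - m + 1 := by
  have h2 := he 2
  have hpos : 0 ≤ n * e 2 - m + 1 := by nlinarith
  refine ⟨(n * e 2 - m + 1).toNat, ?_, by omega⟩
  let f : ℕ → (Fin 4 →₀ ℕ) := fun j => Finsupp.single 0 j + Finsupp.single 3 n
  have hf : Injective f := fun j j' h => by
    have := DFunLike.congr_fun h 0
    simpa [f] using this
  have : {μ | ((wdeg μ = n ∧ m ≤ wt e μ) ∧ μ 1 = 0) ∧ μ 2 = 0} =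
      f '' (Finset.range (n * e 2 - m + 1).toNat) := by
    ext μ
    simp only [Set.mem_ofPred_eq, Set.mem_image, Finset.coe_range, Set.mem_Iio]
    constructor
    · rintro ⟨⟨⟨h3, h4⟩, h5⟩, h6⟩
      simp only [wdeg, wt, h5, h6] at h3 h4
      have h7 : μ 3 = n := by omega
      refine ⟨μ 0, ?_, ?_⟩
      · rw [h7] at h4
        push_cast at h4
        omega
      · ext i
        fin_cases i <;> simp [f, h5, h6, h7]
    · rintro ⟨j, hj, rfl⟩
      simp [f, wdeg, wt]
      omega
  rw [this, hf.encard_image, Set.encard_coe_eq_coe_finsetCard, Finset.card_range]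

theorem encard_sections_two (he : ∀ i, 1 ≤ e i) (n : ℕ) : ∀ (m : ℤ), m ≤ n + 1 →
    ∃ c : ℕ, {μ | (wdeg μ = n ∧ m ≤ wt e μ) ∧ μ 1 = 0}.encard = c ∧
      2 * (c : ℤ) = 2 * (n + 1) * (1 - m) + (e 1 + e 2) * n * (n + 1) := by
  induction n with
  | zero =>
    intro m hm
    obtain ⟨c, hc, hc'⟩ := encard_sections_one he 0 m hm
    refine ⟨c, ?_, ?_⟩
    · rw [← hc]
      congr 1
      ext μ
      simp only [Set.mem_ofPred_eq, wdeg]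
      constructor
      · intro h
        refine ⟨h, ?_⟩
        omega
      · exact fun h => h.1
    · rw [hc']; push_cast; ring
  | succ n ih =>
    intro m hm
    push_cast at hm
    obtain ⟨c, hc, hc'⟩ := encard_sections_one he (n + 1) m (by push_cast; omega)
    have h1 := he 1
    obtain ⟨d, hd, hd'⟩ := ih (m - e 1) (by omega)
    refine ⟨c + d, ?_, ?_⟩
    · rw [encard_eq_add_shift _ 2, Nat.cast_add c d, ← hc, ← hd]
      congr 2
      ext μ
      simp only [Set.mem_ofPred_eq, wdeg_add, wt_add]
      have h1 : wdeg (Finsupp.single 2 1) = 1 := by simp [wdeg]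
      have h2 : wt e (Finsupp.single 2 1) = e 1 := by simp [wt]
      rw [h1, h2]
      simp only [Finsupp.add_apply, Finsupp.single_apply, Nat.cast_add]
      norm_num
      intros
      decide
    · push_cast at *
      linear_combination 2 * hc' + hd'

theorem encard_sections (he : ∀ i, 1 ≤ e i) (n : ℕ) : ∀ (m : ℤ), m ≤ n + 1 →
    ∃ c : ℕ, {μ | wdeg μ = n ∧ m ≤ wt e μ}.encard = c ∧
      6 * (c : ℤ) = 3 * (n + 1) * (n + 2) * (1 - m)
        + n * (n + 1) * (n + 2) * (e 0 + e 1 + e 2) := by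
  induction n with
  | zero =>
    intro m hm
    obtain ⟨c, hc, hc'⟩ := encard_sections_two he 0 m hm
    refine ⟨c, ?_, ?_⟩
    · rw [← hc]
      congr 1
      ext μ
      simp only [Set.mem_ofPred_eq, wdeg]
      constructor
      · intro h
        refine ⟨h, ?_⟩
        omega
      · exact fun h => h.1
    · push_cast at *
      linear_combination 3 * hc'
  | succ n ih =>
    intro m hm
    push_cast at hm
    obtain ⟨c, hc, hc'⟩ := encard_sections_two he (n + 1) m (by push_cast; omega)
    have h1 := he 0
    obtain ⟨d, hd, hd'⟩ := ih (m - e 0) (by omega)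
    refine ⟨c + d, ?_, ?_⟩
    · rw [encard_eq_add_shift _ 1, Nat.cast_add c d, ← hc, ← hd]
      congr 2
      ext μ
      simp only [Set.mem_ofPred_eq, wdeg_add, wt_add]
      have h1 : wdeg (Finsupp.single 1 1) = 1 := by simp [wdeg]
      have h2 : wt e (Finsupp.single 1 1) = e 0 := by simp [wt]
      rw [h1, h2]
      simp
    · push_cast at *
      linear_combination 3 * hc' + hd'

/-- Six times the number of sections of `O(n)(-mH)` when there is no higher cohomology. -/
def sixDim (e : Fin 3 → ℤ) (n m : ℤ) : ℤ :=
  3 * (n + 1) * (n + 2) * (1 - m) + n * (n + 1) * (n + 2) * (e 0 + e 1 + e 2)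

theorem finrank_adm_nat (he : ∀ i, 1 ≤ e i) (n : ℕ) (m : ℤ) (hm : m ≤ n + 1) :
    FiniteDimensional ℂ (Adm e n m) ∧ 6 * (Module.finrank ℂ (Adm e n m) : ℤ) = sixDim e n m := by
  obtain ⟨c, hc, hc'⟩ := encard_sections he n m hm
  have hfin : {μ | wdeg μ = n ∧ m ≤ wt e μ}.Finite := Set.finite_of_encard_eq_coe hc
  have : Finite {μ | wdeg μ = n ∧ m ≤ wt e μ} := hfin
  let B := basisRestrictSupport ℂ {μ | wdeg μ = n ∧ m ≤ wt e μ}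
  refine ⟨Module.Finite.of_basis B, ?_⟩
  have h1 : Module.finrank ℂ (Adm e n m) = c := by
    rw [Adm, Module.finrank_eq_nat_card_basis B, Nat.card_coe_set_eq, Set.ncard, hc]
    rfl
  rw [h1, hc', sixDim]

theorem finiteDimensional_adm (he : ∀ i, 1 ≤ e i) (hm : m ≤ n + 1) :
    FiniteDimensional ℂ (Adm e n m) := by
  rcases lt_or_ge n 0 with h | h
  · rw [adm_eq_bot_of_neg h]; infer_instance
  · lift n to ℕ using h
    exact (finrank_adm_nat he n m hm).1

theorem finrank_adm (he : ∀ i, 1 ≤ e i) (hn : -2 ≤ n) (hm : m ≤ n + 1) :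
    6 * (Module.finrank ℂ (Adm e n m) : ℤ) = sixDim e n m := by
  rcases lt_or_ge n 0 with h | h
  · rw [adm_eq_bot_of_neg h, finrank_bot]
    obtain rfl | rfl : n = -2 ∨ n = -1 := by omega
    · simp [sixDim]
    · simp [sixDim]
  · lift n to ℕ using h
    exact (finrank_adm_nat he n m hm).2

end Scroll

open Scroll

theorem Submodule.finrank_map_add_finrank_inf_ker {V W : Type} [AddCommGroup V] [Module ℂ V]
    [AddCommGroup W] [Module ℂ W] (f : V →ₗ[ℂ] W) (A : Submodule ℂ V) [FiniteDimensional ℂ A] :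
    Module.finrank ℂ (A.map f) + Module.finrank ℂ (A ⊓ LinearMap.ker f : Submodule ℂ V) =
      Module.finrank ℂ A := by
  have h := LinearMap.finrank_range_add_finrank_ker (f.domRestrict A)
  rw [LinearMap.range_domRestrict] at h
  have h2 : Module.finrank ℂ (LinearMap.ker (f.domRestrict A)) =
      Module.finrank ℂ (A ⊓ LinearMap.ker f : Submodule ℂ V) := by
    have h3 : A ⊓ LinearMap.ker f = (LinearMap.ker (f.domRestrict A)).map A.subtype := by
      ext v
      simp [and_comm]
    rw [h3]
    exact (Submodule.equivMapOfInjective _ A.injective_subtype _).finrank_eq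
  omega

namespace Curve

variable {C : Curve} {T : C.Div}

theorem one_mem_twist : (1 : C.F) ∈ C.H0 (C.twist T 0 0) := by
  have h := (C.RL T).one_mem
  change (1 : C.F) ∈ C.H0 ((0 : ℕ) • T) at h
  rw [zero_smul] at h
  rwa [twist, zero_smul, zero_smul, sub_zero]

theorem pow_mem_twist {n m : ℤ} {f : C.F} (hf : f ∈ C.H0 (C.twist T n m)) (k : ℕ) :
    f ^ k ∈ C.H0 (C.twist T (k * n) (k * m)) := by
  induction k with
  | zero => simpa using one_mem_twist
  | succ k ih =>
    have := mul_mem_twist ih hf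
    rw [pow_succ]
    convert this using 3 <;> push_cast <;> ring

theorem twist_anti (hT : ∀ P, 0 ≤ T P) (n : ℤ) {m m' : ℤ} (h : m ≤ m') :
    C.H0 (C.twist T n m') ≤ C.H0 (C.twist T n m) := by
  refine C.H0_mono fun P => ?_
  have := mul_le_mul_of_nonneg_right h (hT P)
  simp only [twist, Finsupp.sub_apply, Finsupp.smul_apply, smul_eq_mul]
  omega

theorem nsmul_sub_eq_twist (n : ℕ) : n • (C.K - T) = C.twist T n n := by
  simp [twist, smul_sub]

end Curve

namespace ScrollData

variable {C : Curve} {T : C.Div} {e : Fin 3 → ℤ}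

/-- Evaluation of polynomials in the function field. -/
def ev (sd : ScrollData C T e) : MvPolynomial (Fin 4) ℂ →ₐ[ℂ] C.F :=
  MvPolynomial.aeval (C.scrollVars sd.x sd.w)

variable {sd : ScrollData C T e}

theorem ev_X_zero : sd.ev (X 0) = sd.x := aeval_X _ _

theorem ev_X_succ (i : Fin 3) : sd.ev (X i.succ) = sd.w i := aeval_X _ _

theorem x_mem : sd.x ∈ C.H0 (C.twist T 0 (-1)) := by
  have h : sd.x ∈ C.H0 T := by
    rw [← sd.pencil_span]
    exact Submodule.subset_span (by simp)
  rwa [Curve.twist, zero_smul, neg_smul, one_smul, sub_neg_eq_add, zero_add]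

theorem Numerics.w_mem (hN : sd.Numerics) (i : Fin 3) : sd.w i ∈ C.H0 (C.twist T 1 (e i)) := by
  have hi := hN.one_le i
  have h : sd.w i ∈ C.H0 (C.K - (e i).toNat • T) := by
    rw [← sd.span_KmT]
    exact Submodule.subset_span ⟨i, 0, by omega, by simp⟩
  have h2 : ((e i).toNat : ℤ) = e i := by omega
  rwa [← natCast_zsmul, h2, ← one_smul ℤ C.K] at h

theorem Numerics.ev_mem (hN : sd.Numerics) {n m : ℤ} {p : MvPolynomial (Fin 4) ℂ}
    (hp : p ∈ Adm e n m) : sd.ev p ∈ C.H0 (C.twist T n m) := by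
  have h : Adm e n m ≤ (C.H0 (C.twist T n m)).comap sd.ev.toLinearMap := by
    rw [Adm, restrictSupport_eq_span, Submodule.span_le]
    rintro _ ⟨μ, ⟨rfl, h2⟩, rfl⟩
    refine Curve.twist_anti hN.eff _ h2 ?_
    change aeval (C.scrollVars sd.x sd.w) (monomial μ 1) ∈ _
    rw [aeval_monomial, Finsupp.prod_fintype _ _ (by simp), map_one, one_mul,
      Fin.prod_univ_four]
    have h := Curve.mul_mem_twist (Curve.mul_mem_twist (Curve.mul_mem_twist
      (Curve.pow_mem_twist (x_mem (sd := sd)) (μ 0)) (Curve.pow_mem_twist (hN.w_mem 0) (μ 1)))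
      (Curve.pow_mem_twist (hN.w_mem 1) (μ 2))) (Curve.pow_mem_twist (hN.w_mem 2) (μ 3))
    convert h using 3
    · rw [wdeg]; ring
    · rw [wt]; ring
    all_goals rfl
  exact h hp

theorem Numerics.map_adm_le (hN : sd.Numerics) (n m : ℤ) :
    (Adm e n m).map sd.ev.toLinearMap ≤ C.H0 (C.twist T n m) := by
  rintro _ ⟨p, hp, rfl⟩
  exact hN.ev_mem hp

theorem Numerics.map_adm_one (hN : sd.Numerics) :
    (Adm e 1 1).map sd.ev.toLinearMap = C.H0 (C.twist T 1 1) := by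
  refine le_antisymm (hN.map_adm_le 1 1) ?_
  have h : C.H0 (C.twist T 1 1) = C.H0 (C.K - 1 • T) := by
    simp [Curve.twist]
  rw [h, ← sd.span_KmT, Submodule.span_le]
  rintro _ ⟨i, j, hj, rfl⟩
  refine ⟨monomial (Finsupp.single 0 j + Finsupp.single i.succ 1) 1, ?_, ?_⟩
  · change _ ∈ Adm e 1 1
    rw [Adm, monomial_mem_restrictSupport]
    left
    push_cast at hj
    fin_cases i <;> simp [wdeg, wt] at hj ⊢ <;> omega
  · change sd.ev _ = _
    rw [← one_mul (1 : ℂ), ← monomial_mul, ← X_pow_eq_monomial, ← X_pow_eq_monomial, pow_one, map_mul,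
      map_pow, ev_X_zero, ev_X_succ]

/-- The polynomials in `Adm e n m` vanishing on the curve. -/
def vanishing (sd : ScrollData C T e) (n m : ℤ) : Submodule ℂ (MvPolynomial (Fin 4) ℂ) :=
  Adm e n m ⊓ LinearMap.ker sd.ev.toLinearMap

theorem mem_vanishing {n m : ℤ} {p : MvPolynomial (Fin 4) ℂ} :
    p ∈ sd.vanishing n m ↔ p ∈ Adm e n m ∧ sd.ev p = 0 := Iff.rfl

theorem Numerics.finrank_vanishing (hN : sd.Numerics) {n m : ℤ} (hm : m ≤ n + 1) :
    Module.finrank ℂ ((Adm e n m).map sd.ev.toLinearMap) +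
      Module.finrank ℂ (sd.vanishing n m) = Module.finrank ℂ (Adm e n m) := by
  have := finiteDimensional_adm hN.one_le hm
  exact Submodule.finrank_map_add_finrank_inf_ker _ _

theorem Numerics.finrank_map_le (hN : sd.Numerics) (n m : ℤ) :
    Module.finrank ℂ ((Adm e n m).map sd.ev.toLinearMap) ≤ C.h0 (C.twist T n m) :=
  Submodule.finrank_mono (hN.map_adm_le n m)

theorem Numerics.vanishing_one (hN : sd.Numerics) : sd.vanishing 1 1 = ⊥ := by
  have := finiteDimensional_adm hN.one_le (n := 1) (m := 1) (by norm_num)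
  have h1 := hN.finrank_vanishing (n := 1) (m := 1) (by norm_num)
  have h2 := finrank_adm hN.one_le (n := 1) (m := 1) (by norm_num) (by norm_num)
  have h3 := C.riemann_roch T
  have h4 := sd.h0_K_sub 1
  have h5 := hN.one_le
  have h6 : C.K - 1 • T = C.twist T 1 1 := by simp [Curve.twist]
  rw [h6, PreCurve.h0, ← hN.map_adm_one, Fin.sum_univ_three] at h4
  have : FiniteDimensional ℂ (sd.vanishing 1 1) :=
    Submodule.finiteDimensional_of_le (inf_le_left : sd.vanishing 1 1 ≤ Adm e 1 1)
  rw [← Submodule.finrank_eq_zero (R := ℂ)]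
  simp only [sixDim] at h2
  have e0 := h5 0
  have e1 := h5 1
  have e2 := h5 2
  omega

end ScrollData

namespace Scroll

variable {e : Fin 3 → ℤ}

/-- A monomial of positive degree in the section ring of `O(1)(-H)` is divisible by a
monomial of degree one. -/
theorem exists_factor (he : ∀ i, 1 ≤ e i) {μ : Fin 4 →₀ ℕ} {i : Fin 3} (hi : 1 ≤ μ i.succ)
    (hw : wdeg μ ≤ wt e μ) : ∃ (j : ℕ) (β : Fin 4 →₀ ℕ), (j : ℤ) + 1 ≤ e i ∧
      Finsupp.single 0 j + Finsupp.single i.succ 1 + β = μ ∧ wdeg β + 1 = wdeg μ ∧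
      wdeg β ≤ wt e β ∧ (1 ≤ μ 0 → 2 ≤ e i → 1 ≤ j) := by
  have hei := he i
  let j := min (μ 0) (e i - 1).toNat
  have hj0 : j ≤ μ 0 := min_le_left _ _
  have hle : Finsupp.single 0 j + Finsupp.single i.succ 1 ≤ μ := by
    intro t
    by_cases h0 : t = 0
    · subst h0
      simpa using hj0
    · by_cases h1 : t = i.succ
      · subst h1
        simpa using hi
      · simp [Ne.symm h0, Ne.symm h1]
  have hμ := add_tsub_cancel_of_le hle
  set β := μ - (Finsupp.single 0 j + Finsupp.single i.succ 1) with hβ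
  refine ⟨j, β, by omega, hμ, ?_⟩
  have hd := wdeg_add (Finsupp.single 0 j + Finsupp.single i.succ 1) β
  have hv := wt_add e (Finsupp.single 0 j + Finsupp.single i.succ 1) β
  have hd' : wdeg (Finsupp.single 0 j + Finsupp.single i.succ 1) = 1 := by
    fin_cases i <;> simp [wdeg]
  have hv' : wt e (Finsupp.single 0 j + Finsupp.single i.succ 1) = e i - j := by
    fin_cases i <;> simp [wt]
  rw [hμ] at hd hv
  have hβ0 : β 0 = μ 0 - j := by simp [hβ]
  have := wdeg_le_of_one_le he β
  refine ⟨by omega, ?_, fun h1 h2 => le_min h1 (by omega)⟩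
  rcases le_total (μ 0) (e i - 1).toNat with h | h
  · have : j = μ 0 := min_eq_left h
    omega
  · have : j = (e i - 1).toNat := min_eq_right h
    omega

theorem exists_pos_of_wdeg_pos {μ : Fin 4 →₀ ℕ} (h : 0 < wdeg μ) :
    ∃ i : Fin 3, 1 ≤ μ i.succ := by
  by_contra! h'
  have h0 : μ 1 < 1 := h' 0
  have h1 : μ 2 < 1 := h' 1
  have h2 : μ 3 < 1 := h' 2
  simp only [wdeg] at h
  omega

theorem monomial_mem_adm_one {i : Fin 3} {j : ℕ} (h : (j : ℤ) + 1 ≤ e i) :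
    monomial (Finsupp.single 0 j + Finsupp.single i.succ 1) 1 ∈ Adm e 1 1 := by
  rw [Adm, monomial_mem_restrictSupport]
  left
  fin_cases i <;> simp [wdeg, wt] at h ⊢ <;> omega

theorem adm_succ_le_mul (he : ∀ i, 1 ≤ e i) {d : ℤ} (hd : 0 ≤ d) :
    Adm e (d + 1) (d + 1) ≤ Adm e 1 1 * Adm e d d := by
  conv_lhs => rw [Adm, restrictSupport_eq_span]
  rw [Submodule.span_le]
  rintro _ ⟨μ, ⟨h1, h2⟩, rfl⟩
  obtain ⟨i, hi⟩ := exists_pos_of_wdeg_pos (μ := μ) (by omega)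
  obtain ⟨j, β, hj, hβ, hdeg, hwt, -⟩ := exists_factor he hi (by omega)
  have : monomial μ (1 : ℂ) =
      monomial (Finsupp.single 0 j + Finsupp.single i.succ 1) 1 * monomial β 1 := by
    rw [monomial_mul, one_mul, hβ]
  change monomial μ (1 : ℂ) ∈ _
  rw [this]
  refine Submodule.mul_mem_mul (monomial_mem_adm_one hj) ?_
  rw [Adm, monomial_mem_restrictSupport]
  left
  constructor <;> omega

end Scroll

namespace ScrollData

variable {C : Curve} {T : C.Div} {e : Fin 3 → ℤ} {sd : ScrollData C T e}

/-- The presentation of the curve as a complete intersection on the scroll, with bidegrees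
in `ℤ`. -/
structure Presentation (sd : ScrollData C T e) (a b : ℤ) (Q₁ Q₂ : MvPolynomial (Fin 4) ℂ) :
    Prop where
  mem₁ : Q₁ ∈ sd.vanishing 2 a
  mem₂ : Q₂ ∈ sd.vanishing 2 b
  exists_of_mem : ∀ n m : ℤ, 2 ≤ n → m ≤ 0 → ∀ p ∈ sd.vanishing n m,
    ∃ U ∈ Adm e (n - 2) (m - a), ∃ V ∈ Adm e (n - 2) (m - b), p = Q₁ * U + Q₂ * V

variable {a b : ℤ} {Q₁ Q₂ : MvPolynomial (Fin 4) ℂ}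

theorem CI.presentation (h : sd.CI a b Q₁ Q₂) : sd.Presentation a b Q₁ Q₂ := by
  obtain ⟨h1, h2, h3, h4, h5⟩ := h
  rw [admSub_eq] at h1 h2
  refine ⟨⟨h1, h3⟩, ⟨h2, h4⟩, ?_⟩
  intro n m hn hm p hp
  obtain ⟨k, rfl⟩ : ∃ k : ℕ, n = (k + 2 : ℕ) := ⟨(n - 2).toNat, by push_cast; omega⟩
  have h6 : p ∈ AdmSub e (k + 2) m ⊓ LinearMap.ker (C.scrollEval sd.x sd.w) := by
    rw [admSub_eq]; exact hp
  rw [h5 k m hm, admSub_eq, admSub_eq] at h6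
  obtain ⟨_, ⟨U, hU, rfl⟩, _, ⟨V, hV, rfl⟩, rfl⟩ := Submodule.mem_sup.mp h6
  have hk : ((k + 2 : ℕ) : ℤ) - 2 = k := by push_cast; ring
  rw [hk]
  exact ⟨U, hU, V, hV, rfl⟩

namespace Presentation

theorem symm (h : sd.Presentation a b Q₁ Q₂) : sd.Presentation b a Q₂ Q₁ := by
  refine ⟨h.mem₂, h.mem₁, fun n m hn hm p hp => ?_⟩
  obtain ⟨U, hU, V, hV, rfl⟩ := h.exists_of_mem n m hn hm p hp
  exact ⟨V, hV, U, hU, add_comm _ _⟩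

theorem ne_zero₁ (h : sd.Presentation a b Q₁ Q₂) (hN : sd.Numerics) : Q₁ ≠ 0 := by
  rintro rfl
  have hg := hN.genus_ge
  have hs := hN.sum_e
  have h1 : sd.vanishing 2 (-|b|) ≤ (Adm e 0 (-|b| - b)).map (LinearMap.mulLeft ℂ Q₂) := by
    intro p hp
    obtain ⟨U, -, V, hV, rfl⟩ := h.exists_of_mem 2 _ le_rfl (by simp) p hp
    exact ⟨V, by simpa using hV, by simp⟩
  have hb := neg_abs_le b
  have hb' := le_abs_self b
  have hb0 := abs_nonneg b
  have := finiteDimensional_adm hN.one_le (n := 0) (m := -|b| - b) (by omega)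
  have h2 := (Submodule.finrank_mono h1).trans (Submodule.finrank_map_le _ _)
  have h3 := hN.finrank_vanishing (n := 2) (m := -|b|) (by omega)
  have h4 := hN.finrank_map_le 2 (-|b|)
  have h5 := Curve.h0_twist (C := C) hN.deg_T hg (n := 2) (m := -|b|) le_rfl (by omega)
  have h6 := finrank_adm hN.one_le (n := 2) (m := -|b|) (by omega) (by omega)
  have h7 := finrank_adm hN.one_le (n := 0) (m := -|b| - b) (by omega) (by omega)
  simp only [sixDim] at h6 h7
  omega

theorem ne_zero₂ (h : sd.Presentation a b Q₁ Q₂) (hN : sd.Numerics) : Q₂ ≠ 0 :=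
  h.symm.ne_zero₁ hN

end Presentation

theorem mul_mem_vanishing {n n' m m' : ℤ} {p q : MvPolynomial (Fin 4) ℂ}
    (hp : p ∈ sd.vanishing n m) (hq : q ∈ Adm e n' m') :
    p * q ∈ sd.vanishing (n + n') (m + m') :=
  ⟨mul_mem_adm hp.1 hq, by
    change sd.ev (p * q) = 0
    rw [map_mul, (mem_vanishing.mp hp).2, zero_mul]⟩

theorem piece_eq (n : ℕ) : (C.RL (C.K - T)).piece n = C.H0 (C.twist T n n) := by
  change C.H0 (n • (C.K - T)) = _
  rw [Curve.nsmul_sub_eq_twist]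

theorem Numerics.map_adm_eq_piece (hN : sd.Numerics) (hq : (C.RL (C.K - T)).IsQuadratic)
    {n : ℕ} (hn : 1 ≤ n) :
    (Adm e n n).map sd.ev.toLinearMap = (C.RL (C.K - T)).piece n := by
  induction n, hn using Nat.le_induction with
  | base => rw [piece_eq]; exact hN.map_adm_one
  | succ d hd ih =>
    refine le_antisymm (by rw [piece_eq]; exact hN.map_adm_le _ _) ?_
    intro y hy
    obtain ⟨z, hz⟩ := hq.linMul_surjective d ⟨y, hy⟩
    replace hz : ((C.RL (C.K - T)).linMul d z : C.F) = y := congrArg Subtype.val hz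
    rw [← hz]
    clear hz
    induction z with
    | zero => simp
    | add u v hu hv => rw [map_add, Submodule.coe_add]; exact add_mem hu hv
    | tmul u v =>
      obtain ⟨p, hp, hp'⟩ : (u : C.F) ∈ (Adm e 1 1).map sd.ev.toLinearMap := by
        rw [hN.map_adm_one]
        exact (piece_eq (T := T) 1).le u.2
      obtain ⟨q, hq, hq'⟩ : (v : C.F) ∈ (Adm e d d).map sd.ev.toLinearMap := ih.ge v.2
      refine ⟨p * q, ?_, ?_⟩
      · have := mul_mem_adm hp hq
        rw [add_comm (1 : ℤ) d] at this
        exact_mod_cast this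
      · rw [GradedSystem.linMul_tmul, ← hp', ← hq']
        exact map_mul sd.ev p q

/-- In a quadratic algebra, the cubic relations are generated by the quadratic ones. -/
theorem Numerics.vanishing_three_le (hN : sd.Numerics) (hq : (C.RL (C.K - T)).IsQuadratic) :
    sd.vanishing 3 3 ≤ Adm e 1 1 * sd.vanishing 2 2 := by
  set S := C.RL (C.K - T) with hS
  have hsec : ∀ n : ℕ, 1 ≤ n → ∃ σ : S.piece n →ₗ[ℂ] MvPolynomial (Fin 4) ℂ,
      (∀ y, σ y ∈ Adm e n n) ∧ ∀ y, sd.ev (σ y) = y := by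
    intro n hn
    have hmap := hN.map_adm_eq_piece hq hn
    let f : Adm e n n →ₗ[ℂ] S.piece n := sd.ev.toLinearMap.restrict (fun p hp => by
      rw [← hmap]; exact ⟨p, hp, rfl⟩)
    have hf : LinearMap.range f = ⊤ := by
      rw [LinearMap.range_eq_top]
      rintro ⟨y, hy⟩
      rw [← hmap] at hy
      obtain ⟨p, hp, rfl⟩ := hy
      exact ⟨⟨p, hp⟩, rfl⟩
    obtain ⟨g, hg⟩ := f.exists_rightInverse_of_surjective hf
    refine ⟨(Adm e n n).subtype ∘ₗ g, fun y => (g y).2, fun y => ?_⟩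
    exact congrArg Subtype.val (LinearMap.congr_fun hg y)
  obtain ⟨σ₁, hσ₁, hσ₁'⟩ := hsec 1 le_rfl
  obtain ⟨σ₂, hσ₂, hσ₂'⟩ := hsec 2 one_le_two
  replace hσ₁ : ∀ y, σ₁ y ∈ Adm e 1 1 := fun y => by exact_mod_cast hσ₁ y
  replace hσ₂ : ∀ y, σ₂ y ∈ Adm e 2 2 := fun y => by exact_mod_cast hσ₂ y
  have hσ₁ev : ∀ l ∈ Adm e 1 1, ∀ y : S.piece 1, (y : C.F) = sd.ev l → σ₁ y = l := by
    intro l hl y hy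
    have : σ₁ y - l ∈ sd.vanishing 1 1 := by
      refine mem_vanishing.mpr ⟨sub_mem (hσ₁ y) hl, ?_⟩
      rw [map_sub, hσ₁', hy, sub_self]
    rw [hN.vanishing_one] at this
    exact sub_eq_zero.mp this
  let N := Adm e 1 1 * sd.vanishing 2 2
  let L : S.piece 1 ⊗[ℂ] S.piece 2 →ₗ[ℂ] MvPolynomial (Fin 4) ℂ :=
    LinearMap.mul' ℂ _ ∘ₗ TensorProduct.map σ₁ σ₂
  let M : S.piece 1 ⊗[ℂ] S.piece 1 →ₗ[ℂ] MvPolynomial (Fin 4) ℂ :=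
    LinearMap.mul' ℂ _ ∘ₗ TensorProduct.map σ₁ σ₁
  have hM : ∀ t, M t ∈ Adm e 2 2 ∧ sd.ev (M t) = S.linMul 1 t := by
    intro t
    induction t with
    | zero => simp
    | add u v hu hv =>
      rw [map_add, map_add, map_add, Submodule.coe_add, hu.2, hv.2]
      exact ⟨add_mem hu.1 hv.1, rfl⟩
    | tmul u v =>
      have h1 : M (u ⊗ₜ v) = σ₁ u * σ₁ v := by simp [M]
      rw [h1]
      exact ⟨mul_mem_adm (hσ₁ u) (hσ₁ v), by rw [map_mul, hσ₁', hσ₁']; rfl⟩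
  have hL : ∀ (r : S.piece 1) (t : S.piece 1 ⊗[ℂ] S.piece 1),
      L (S.freeMul (S.piece 1) 1 (t ⊗ₜ r)) - M t * σ₁ r ∈ N := by
    intro r t
    induction t with
    | zero => simp
    | add u v hu hv =>
      rw [TensorProduct.add_tmul, map_add, map_add, map_add, add_mul, add_sub_add_comm]
      exact add_mem hu hv
    | tmul u v =>
      have h1 : M (u ⊗ₜ v) = σ₁ u * σ₁ v := by simp [M]
      have h2 : L (S.freeMul (S.piece 1) 1 ((u ⊗ₜ v) ⊗ₜ r)) =
          σ₁ u * σ₂ (S.linMul 1 (v ⊗ₜ r)) := by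
        rw [GradedSystem.freeMul_tmul]
        simp [L]
      rw [h1, h2, mul_assoc, ← mul_sub]
      refine Submodule.mul_mem_mul (hσ₁ u) (mem_vanishing.mpr ⟨?_, ?_⟩)
      · exact sub_mem (hσ₂ _) (mul_mem_adm (hσ₁ v) (hσ₁ r))
      · rw [map_sub, map_mul, hσ₂', hσ₁', hσ₁', GradedSystem.linMul_tmul, sub_self]
  have hker : ∀ z ∈ LinearMap.ker (S.linMul 2), L z ∈ N := by
    intro z hz
    refine (Submodule.span_le (p := N.comap L)).mpr ?_ (hq.ker_linMul_le 1 hz)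
    rintro _ ⟨t, ht, r, rfl⟩
    have h1 := hL r t
    have h2 : M t ∈ sd.vanishing 2 2 := by
      refine mem_vanishing.mpr ⟨(hM t).1, ?_⟩
      rw [(hM t).2, LinearMap.mem_ker.mp ht]
      rfl
    have h3 : M t * σ₁ r ∈ N := by
      rw [mul_comm]
      exact Submodule.mul_mem_mul (hσ₁ r) h2
    have := add_mem h1 h3
    rwa [sub_add_cancel] at this
  have hlift : ∀ P ∈ Adm e 1 1 * Adm e 2 2, ∃ z, (S.linMul 2 z : C.F) = sd.ev P ∧ L z - P ∈ N := by
    intro P hP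
    induction hP using Submodule.mul_induction_on' with
    | mem_mul_mem l hl p hp =>
      have h1 : sd.ev l ∈ S.piece 1 := by
        rw [← hN.map_adm_eq_piece hq le_rfl]; exact ⟨l, by exact_mod_cast hl, rfl⟩
      have h2 : sd.ev p ∈ S.piece 2 := by
        rw [← hN.map_adm_eq_piece hq one_le_two]; exact ⟨p, by exact_mod_cast hp, rfl⟩
      refine ⟨⟨_, h1⟩ ⊗ₜ ⟨_, h2⟩, by simp, ?_⟩
      have h3 : L (⟨_, h1⟩ ⊗ₜ ⟨_, h2⟩) = σ₁ ⟨_, h1⟩ * σ₂ ⟨_, h2⟩ := by simp [L]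
      rw [h3, hσ₁ev l hl _ rfl, ← mul_sub]
      refine Submodule.mul_mem_mul hl (mem_vanishing.mpr ⟨sub_mem (hσ₂ _) hp, ?_⟩)
      rw [map_sub, hσ₂', sub_self]
    | add P _ P' _ h h' =>
      obtain ⟨z, hz, hz'⟩ := h
      obtain ⟨w, hw, hw'⟩ := h'
      refine ⟨z + w, by rw [map_add, map_add, Submodule.coe_add, hz, hw], ?_⟩
      rw [map_add, add_sub_add_comm]
      exact add_mem hz' hw'
  intro P hP
  obtain ⟨hP1, hP2⟩ := mem_vanishing.mp hP
  obtain ⟨z, hz, hz'⟩ := hlift P (adm_succ_le_mul hN.one_le (d := 2) (by norm_num)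
    (by norm_num; exact hP1))
  have hz0 : z ∈ LinearMap.ker (S.linMul 2) := by
    rw [LinearMap.mem_ker]
    exact Subtype.ext (hz.trans hP2)
  have := sub_mem (hker z hz0) hz'
  rwa [sub_sub_cancel] at this

theorem Presentation.two_le_of_isQuadratic (h : sd.Presentation a b Q₁ Q₂) (hN : sd.Numerics)
    (hab : a + b = (C.genus : ℤ) - 5) (hq : (C.RL (C.K - T)).IsQuadratic) : 2 ≤ a := by
  have he := hN.one_le
  have hs := hN.sum_e
  have hg := hN.genus_ge
  have hQ := h.ne_zero₂ hN
  have hinj : Injective (LinearMap.mulLeft ℂ Q₂) := fun p q hpq => mul_left_cancel₀ hQ hpq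
  have hdim : ∀ m, Module.finrank ℂ ((Adm e 0 m).map (LinearMap.mulLeft ℂ Q₂)) =
      Module.finrank ℂ (Adm e 0 m) := fun m =>
    (Submodule.equivMapOfInjective _ hinj _).finrank_eq.symm
  have v2 := hN.finrank_vanishing (n := 2) (m := 2) (by norm_num)
  have v3 := hN.finrank_vanishing (n := 3) (m := 3) (by norm_num)
  have p2 := hN.map_adm_eq_piece hq one_le_two
  have p3 := hN.map_adm_eq_piece hq (n := 3) (by norm_num)
  rw [piece_eq] at p2 p3
  norm_num at p2 p3
  rw [p2] at v2
  rw [p3] at v3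
  have r2 := Curve.h0_twist (C := C) hN.deg_T hg (n := 2) (m := 2) le_rfl le_rfl
  have r3 := Curve.h0_twist (C := C) hN.deg_T hg (n := 3) (m := 3) (by norm_num) le_rfl
  have d2 := finrank_adm he (n := 2) (m := 2) (by norm_num) (by norm_num)
  have d3 := finrank_adm he (n := 3) (m := 3) (by norm_num) (by norm_num)
  rw [PreCurve.h0] at r2 r3
  simp only [sixDim] at d2 d3
  have := finiteDimensional_adm he (n := 2) (m := 2) (by norm_num)
  have hfin : FiniteDimensional ℂ (sd.vanishing 2 2) :=
    Submodule.finiteDimensional_of_le (inf_le_left : sd.vanishing 2 2 ≤ Adm e 2 2)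
  have hle : (Adm e 0 (2 - b)).map (LinearMap.mulLeft ℂ Q₂) ≤ sd.vanishing 2 2 := by
    rintro _ ⟨p, hp, rfl⟩
    have := mul_mem_vanishing h.mem₂ hp
    rwa [add_zero, add_sub_cancel] at this
  have hle' := Submodule.finrank_mono hle
  rw [hdim] at hle'
  have hb : 1 ≤ b ∨ 1 < a := by omega
  by_contra! ha
  have d0 := finrank_adm he (n := 0) (m := 2 - b) (by norm_num) (by omega)
  simp only [sixDim] at d0
  have ha1 : a = 1 := by omega
  have heq := Submodule.eq_of_le_of_finrank_eq hle (by rw [hdim]; omega)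
  have h3 : sd.vanishing 3 3 ≤ (Adm e 1 (3 - b)).map (LinearMap.mulLeft ℂ Q₂) := by
    refine (hN.vanishing_three_le hq).trans ?_
    rw [Submodule.mul_le]
    intro l hl p hp
    rw [← heq] at hp
    obtain ⟨u, hu, rfl⟩ := hp
    refine ⟨l * u, ?_, ?_⟩
    · have := mul_mem_adm hl hu
      rwa [add_zero, ← add_sub_assoc, show (1 : ℤ) + 2 = 3 by norm_num] at this
    · simp only [LinearMap.mulLeft_apply]
      ring
  have := finiteDimensional_adm he (n := 1) (m := 3 - b) (by omega)
  have h4 := (Submodule.finrank_mono h3).trans (Submodule.finrank_map_le _ _)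
  have d1 := finrank_adm he (n := 1) (m := 3 - b) (by norm_num) (by omega)
  simp only [sixDim] at d1
  omega

end ScrollData

/-- The product of two submodules is the product of the underlying modules. -/
def Submodule.prodEquivProd {R M N : Type*} [Semiring R] [AddCommMonoid M] [AddCommMonoid N]
    [Module R M] [Module R N] (p : Submodule R M) (q : Submodule R N) : p.prod q ≃ₗ[R] p × q where
  toFun x := (⟨x.1.1, x.2.1⟩, ⟨x.1.2, x.2.2⟩)
  invFun x := ⟨(x.1, x.2), x.1.2, x.2.2⟩
  map_add' _ _ := rfl
  map_smul' _ _ := rfl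
  left_inv _ := rfl
  right_inv _ := rfl

namespace Scroll

variable {e : Fin 3 → ℤ} {n n' m m' : ℤ} {p q : MvPolynomial (Fin 4) ℂ}

theorem adm_cast (hp : p ∈ Adm e n m) (hn : n = n') (hm : m' ≤ m) : p ∈ Adm e n' m' :=
  hn ▸ adm_anti hm hp

theorem bih_cast (hp : p ∈ Bih e n m) (hn : n = n') (hm : m = m') : p ∈ Bih e n' m' :=
  hn ▸ hm ▸ hp

theorem eq_of_mem_bih (hp : p ∈ Bih e n m) (hq : q ∈ Bih e n m) (h : p - q ∈ Adm e n (m + 1)) :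
    p = q :=
  sub_eq_zero.mp (eq_zero_of_mem_bih_adm (sub_mem hp hq) h)

end Scroll

namespace ScrollData

variable {C : Curve} {T : C.Div} {e : Fin 3 → ℤ} {sd : ScrollData C T e}
  {a b : ℤ} {Q₁ Q₂ : MvPolynomial (Fin 4) ℂ}

namespace Presentation

theorem numeric (h : sd.Presentation a b Q₁ Q₂) (hN : sd.Numerics)
    (hab : a + b = (C.genus : ℤ) - 5) (ha : 2 ≤ a) (hb : 2 ≤ b) {n m : ℤ} (hn : 2 ≤ n)
    (hm : m ≤ 0) :
    (Adm e n m).map sd.ev.toLinearMap = C.H0 (C.twist T n m) ∧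
    ∀ U ∈ Adm e (n - 2) (m - a), ∀ V ∈ Adm e (n - 2) (m - b), Q₁ * U + Q₂ * V = 0 →
      ∃ S ∈ Adm e (n - 4) (m - a - b), U = Q₂ * S ∧ V = -(Q₁ * S) := by
  have he := hN.one_le
  have hs := hN.sum_e
  have hQ := h.ne_zero₂ hN
  let A := (Adm e (n - 2) (m - a)).prod (Adm e (n - 2) (m - b))
  let f : MvPolynomial (Fin 4) ℂ × MvPolynomial (Fin 4) ℂ →ₗ[ℂ] MvPolynomial (Fin 4) ℂ :=
    (LinearMap.mulLeft ℂ Q₁).coprod (LinearMap.mulLeft ℂ Q₂)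
  let κ : MvPolynomial (Fin 4) ℂ →ₗ[ℂ] MvPolynomial (Fin 4) ℂ × MvPolynomial (Fin 4) ℂ :=
    (LinearMap.mulLeft ℂ Q₂).prod (-LinearMap.mulLeft ℂ Q₁)
  have hκ : Injective κ := fun p q hpq => mul_left_cancel₀ hQ (congrArg Prod.fst hpq)
  have f1 := finiteDimensional_adm he (n := n - 2) (m := m - a) (by omega)
  have f2 := finiteDimensional_adm he (n := n - 2) (m := m - b) (by omega)
  have f3 := finiteDimensional_adm he (n := n - 4) (m := m - a - b) (by omega)
  have f4 := finiteDimensional_adm he (n := n) (m := m) (by omega)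
  have eA : A ≃ₗ[ℂ] Adm e (n - 2) (m - a) × Adm e (n - 2) (m - b) := Submodule.prodEquivProd _ _
  have fA : FiniteDimensional ℂ A := eA.symm.finiteDimensional
  have hA : Module.finrank ℂ A = Module.finrank ℂ (Adm e (n - 2) (m - a)) +
      Module.finrank ℂ (Adm e (n - 2) (m - b)) := by
    rw [eA.finrank_eq, Module.finrank_prod]
  have hmap : sd.vanishing n m ≤ A.map f := by
    intro p hp
    obtain ⟨U, hU, V, hV, rfl⟩ := h.exists_of_mem n m hn hm p hp
    exact ⟨(U, V), ⟨hU, hV⟩, rfl⟩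
  have hkos : (Adm e (n - 4) (m - a - b)).map κ ≤ A ⊓ LinearMap.ker f := by
    rintro _ ⟨S, hS, rfl⟩
    refine ⟨⟨?_, ?_⟩, ?_⟩
    · exact adm_cast (mul_mem_adm h.mem₂.1 hS) (by ring) (by omega)
    · exact neg_mem (adm_cast (mul_mem_adm h.mem₁.1 hS) (by ring) (by omega))
    · change Q₁ * (Q₂ * S) + Q₂ * -(Q₁ * S) = 0
      ring
  have k1 := Submodule.finrank_map_add_finrank_inf_ker f A
  have k2 := hN.finrank_vanishing (n := n) (m := m) (by omega)
  have k3 := hN.finrank_map_le n m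
  have k4 := Submodule.finrank_mono hmap
  have k5 := Submodule.finrank_mono hkos
  rw [← (Submodule.equivMapOfInjective κ hκ _).finrank_eq] at k5
  have r := Curve.h0_twist (C := C) hN.deg_T hN.genus_ge hn (m := m) (by omega)
  have d := finrank_adm he (n := n) (m := m) (by omega) (by omega)
  have da := finrank_adm he (n := n - 2) (m := m - a) (by omega) (by omega)
  have db := finrank_adm he (n := n - 2) (m := m - b) (by omega) (by omega)
  have dab := finrank_adm he (n := n - 4) (m := m - a - b) (by omega) (by omega)
  have key : sixDim e n m - sixDim e (n - 2) (m - a) - sixDim e (n - 2) (m - b) +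
      sixDim e (n - 4) (m - a - b) = 6 * (n * (2 * C.genus - 2) - 4 * m + 1 - C.genus) := by
    have hb' : b = (C.genus : ℤ) - 5 - a := by omega
    subst hb'
    simp only [sixDim, hs]
    ring
  rw [← r, ← d, ← da, ← db, ← dab] at key
  rw [PreCurve.h0] at k3 key
  constructor
  · exact Submodule.eq_of_le_of_finrank_le (hN.map_adm_le n m) (by omega)
  · intro U hU V hV hUV
    have heq := Submodule.eq_of_le_of_finrank_le hkos (by
      rw [← (Submodule.equivMapOfInjective κ hκ _).finrank_eq]; omega)
    have hmem : (U, V) ∈ A ⊓ LinearMap.ker f := ⟨⟨hU, hV⟩, hUV⟩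
    rw [← heq] at hmem
    obtain ⟨S, hS, hS'⟩ := hmem
    exact ⟨S, hS, (congrArg Prod.fst hS').symm, (congrArg Prod.snd hS').symm⟩

theorem map_adm_nat (h : sd.Presentation a b Q₁ Q₂) (hN : sd.Numerics)
    (hab : a + b = (C.genus : ℤ) - 5) (ha : 2 ≤ a) (hb : 2 ≤ b) {n : ℤ} (hn : 2 ≤ n) (j : ℕ) :
    (j : ℤ) ≤ n → (Adm e n j).map sd.ev.toLinearMap = C.H0 (C.twist T n j) := by
  induction j with
  | zero => exact fun _ => (h.numeric hN hab ha hb hn le_rfl).1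
  | succ j ih =>
    intro hj
    push_cast at hj
    refine le_antisymm (hN.map_adm_le _ _) ?_
    intro f hf
    have hf' := Curve.twist_anti hN.eff n (m := j) (by push_cast; omega) hf
    rw [← ih (by omega)] at hf'
    obtain ⟨P, hP, rfl⟩ := hf'
    obtain ⟨p, hp, r, hr, rfl⟩ := exists_top hP
    have hev : sd.ev (X 0 ^ (j + 1) * p) ∈ C.H0 (C.twist T n 0) := by
      have h1 := sub_mem hf (hN.ev_mem (adm_cast hr rfl (m' := ((j + 1 : ℕ) : ℤ)) (by simp)))
      have h2 := Curve.mul_mem_twist (Curve.pow_mem_twist (x_mem (sd := sd)) (j + 1)) h1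
      have h3 : sd.ev (X 0 ^ (j + 1) * p) = sd.x ^ (j + 1) * (sd.ev (p + r) - sd.ev r) := by
        rw [map_mul, map_pow, ev_X_zero, map_add, add_sub_cancel_right]
      rw [h3]
      convert h2 using 3 <;> first | ring1 | rfl
    rw [← (h.numeric hN hab ha hb hn le_rfl).1] at hev
    obtain ⟨P', hP', hev⟩ := hev
    replace hev : sd.ev P' = sd.ev (X 0 ^ (j + 1) * p) := hev
    have hXp := X_pow_mul_mem_bih (j + 1) hp
    have hv : X 0 ^ (j + 1) * p - P' ∈ sd.vanishing n (-1) := by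
      refine mem_vanishing.mpr ⟨sub_mem (adm_cast (bih_le_adm hXp) rfl (by push_cast; omega))
        (adm_cast hP' rfl (by omega)), ?_⟩
      rw [map_sub, hev, sub_self]
    obtain ⟨U, hU, V, hV, hUV⟩ := h.exists_of_mem n (-1) hn (by omega) _ hv
    obtain ⟨u, hu, U', hU', rfl⟩ := exists_top hU
    obtain ⟨v, hv, V', hV', rfl⟩ := exists_top hV
    obtain ⟨q₁, hq₁, r₁, hr₁, hQ₁⟩ := exists_top h.mem₁.1
    obtain ⟨q₂, hq₂, r₂, hr₂, hQ₂⟩ := exists_top h.mem₂.1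
    have htop : X 0 ^ (j + 1) * p = q₁ * u + q₂ * v := by
      refine eq_of_mem_bih (e := e) (n := n) (m := -1) (bih_cast hXp rfl (by push_cast; ring))
        (add_mem (bih_cast (mul_mem_bih hq₁ hu) (by ring) (by ring))
          (bih_cast (mul_mem_bih hq₂ hv) (by ring) (by ring))) ?_
      have : X 0 ^ (j + 1) * p - (q₁ * u + q₂ * v) =
          P' + (Q₁ * U' + r₁ * u) + (Q₂ * V' + r₂ * v) := by
        rw [sub_eq_iff_eq_add.mp hUV, hQ₁, hQ₂]
        ring
      rw [this]
      refine add_mem (add_mem (adm_cast hP' rfl (by omega)) (add_mem ?_ ?_)) (add_mem ?_ ?_)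
      · exact adm_cast (mul_mem_adm h.mem₁.1 hU') (by ring) (by omega)
      · exact adm_cast (mul_mem_adm hr₁ (bih_le_adm hu)) (by ring) (by omega)
      · exact adm_cast (mul_mem_adm h.mem₂.1 hV') (by ring) (by omega)
      · exact adm_cast (mul_mem_adm hr₂ (bih_le_adm hv)) (by ring) (by omega)
    obtain ⟨u', hu', rfl⟩ := exists_eq_X_pow_mul hN.one_le (j + 1) (m := j - a) (n := n - 2)
      (by omega) (bih_cast hu rfl (by push_cast; ring))
    obtain ⟨v', hv', rfl⟩ := exists_eq_X_pow_mul hN.one_le (j + 1) (m := j - b) (n := n - 2)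
      (by omega) (bih_cast hv rfl (by push_cast; ring))
    have hp' : p = q₁ * u' + q₂ * v' := by
      refine mul_left_cancel₀ (pow_ne_zero (j + 1) (X_ne_zero (R := ℂ) (0 : Fin 4))) ?_
      rw [htop]
      ring
    refine ⟨r - (r₁ * u' + r₂ * v'), ?_, ?_⟩
    · refine sub_mem (adm_cast hr rfl (by simp)) (add_mem ?_ ?_)
      · exact adm_cast (mul_mem_adm hr₁ (bih_le_adm hu')) (by ring) (by push_cast; omega)
      · exact adm_cast (mul_mem_adm hr₂ (bih_le_adm hv')) (by ring) (by push_cast; omega)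
    · change sd.ev _ = sd.ev _
      have : r - (r₁ * u' + r₂ * v') = (p + r) - (Q₁ * u' + Q₂ * v') := by
        rw [hp', hQ₁, hQ₂]
        ring
      rw [this, map_sub, map_add sd.ev (Q₁ * u'), map_mul, map_mul, (mem_vanishing.mp h.mem₁).2,
        (mem_vanishing.mp h.mem₂).2]
      ring

theorem exists_of_mem_nat (h : sd.Presentation a b Q₁ Q₂) (hN : sd.Numerics)
    (hab : a + b = (C.genus : ℤ) - 5) (ha : 2 ≤ a) (hb : 2 ≤ b) {n : ℤ} (hn : 2 ≤ n) (j : ℕ) :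
    (j : ℤ) ≤ n → ∀ p ∈ sd.vanishing n j,
      ∃ U ∈ Adm e (n - 2) (j - a), ∃ V ∈ Adm e (n - 2) (j - b), p = Q₁ * U + Q₂ * V := by
  induction j with
  | zero => exact fun _ => h.exists_of_mem n 0 hn le_rfl
  | succ j ih =>
    intro hj P hP
    push_cast at hj
    obtain ⟨U, hU, V, hV, rfl⟩ := ih (by omega) P
      ⟨adm_cast hP.1 rfl (by push_cast; omega), hP.2⟩
    obtain ⟨u, hu, U', hU', rfl⟩ := exists_top hU
    obtain ⟨v, hv, V', hV', rfl⟩ := exists_top hV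
    obtain ⟨q₁, hq₁, r₁, hr₁, hQ₁⟩ := exists_top h.mem₁.1
    obtain ⟨q₂, hq₂, r₂, hr₂, hQ₂⟩ := exists_top h.mem₂.1
    have htop : q₁ * u + q₂ * v = 0 := by
      refine eq_zero_of_mem_bih_adm (e := e) (n := n) (m := j)
        (add_mem (bih_cast (mul_mem_bih hq₁ hu) (by ring) (by ring))
          (bih_cast (mul_mem_bih hq₂ hv) (by ring) (by ring))) ?_
      have : q₁ * u + q₂ * v = (Q₁ * (u + U') + Q₂ * (v + V')) -
          ((Q₁ * U' + r₁ * u) + (Q₂ * V' + r₂ * v)) := by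
        rw [hQ₁, hQ₂]
        ring
      rw [this]
      refine sub_mem (adm_cast hP.1 rfl (by simp)) (add_mem (add_mem ?_ ?_) (add_mem ?_ ?_))
      · exact adm_cast (mul_mem_adm h.mem₁.1 hU') (by ring) (by omega)
      · exact adm_cast (mul_mem_adm hr₁ (bih_le_adm hu)) (by ring) (by omega)
      · exact adm_cast (mul_mem_adm h.mem₂.1 hV') (by ring) (by omega)
      · exact adm_cast (mul_mem_adm hr₂ (bih_le_adm hv)) (by ring) (by omega)
    have hlow : X 0 ^ (j + 1) * (Q₁ * u + Q₂ * v) ∈ sd.vanishing n 0 := by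
      refine mem_vanishing.mpr ⟨?_, ?_⟩
      · have h1 : Q₁ * u + Q₂ * v ∈ Adm e n (j + 1) := by
          have : Q₁ * u + Q₂ * v = r₁ * u + r₂ * v := by
            rw [hQ₁, hQ₂]
            linear_combination htop
          rw [this]
          refine add_mem ?_ ?_
          · exact adm_cast (mul_mem_adm hr₁ (bih_le_adm hu)) (by ring) (by omega)
          · exact adm_cast (mul_mem_adm hr₂ (bih_le_adm hv)) (by ring) (by omega)
        exact adm_cast (X_pow_mul_mem_adm (j + 1) h1) rfl (by simp)
      · rw [map_mul, map_add, map_mul, map_mul, (mem_vanishing.mp h.mem₁).2,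
          (mem_vanishing.mp h.mem₂).2]
        ring
    obtain ⟨U₂, hU₂, V₂, hV₂, hUV⟩ := h.exists_of_mem n 0 hn le_rfl _ hlow
    have hXu := X_pow_mul_mem_bih (j + 1) hu
    have hXv := X_pow_mul_mem_bih (j + 1) hv
    obtain ⟨S, hS, hS₁, hS₂⟩ := (h.numeric hN hab ha hb hn (m := -1) (by omega)).2
      (X 0 ^ (j + 1) * u - U₂)
      (sub_mem (adm_cast (bih_le_adm hXu) rfl (by push_cast; omega))
        (adm_cast hU₂ rfl (by omega)))
      (X 0 ^ (j + 1) * v - V₂)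
      (sub_mem (adm_cast (bih_le_adm hXv) rfl (by push_cast; omega))
        (adm_cast hV₂ rfl (by omega)))
      (by linear_combination hUV)
    obtain ⟨s', hs', S', hS', rfl⟩ := exists_top hS
    have hu2 : X 0 ^ (j + 1) * u = q₂ * s' := by
      refine eq_of_mem_bih (e := e) (n := n - 2) (m := -1 - a)
        (bih_cast hXu rfl (by push_cast; ring))
        (bih_cast (mul_mem_bih hq₂ hs') (by ring) (by ring)) ?_
      have : X 0 ^ (j + 1) * u - q₂ * s' = U₂ + (Q₂ * S' + r₂ * s') := by
        rw [sub_eq_iff_eq_add.mp hS₁, hQ₂]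
        ring
      rw [this]
      refine add_mem (adm_cast hU₂ rfl (by omega)) (add_mem ?_ ?_)
      · exact adm_cast (mul_mem_adm h.mem₂.1 hS') (by ring) (by omega)
      · exact adm_cast (mul_mem_adm hr₂ (bih_le_adm hs')) (by ring) (by omega)
    have hv2 : X 0 ^ (j + 1) * v = -(q₁ * s') := by
      refine eq_of_mem_bih (e := e) (n := n - 2) (m := -1 - b)
        (bih_cast hXv rfl (by push_cast; ring))
        (neg_mem (bih_cast (mul_mem_bih hq₁ hs') (by ring) (by ring))) ?_
      have : X 0 ^ (j + 1) * v - -(q₁ * s') = V₂ - (Q₁ * S' + r₁ * s') := by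
        rw [sub_eq_iff_eq_add.mp hS₂, hQ₁]
        ring
      rw [this]
      refine sub_mem (adm_cast hV₂ rfl (by omega)) (add_mem ?_ ?_)
      · exact adm_cast (mul_mem_adm h.mem₁.1 hS') (by ring) (by omega)
      · exact adm_cast (mul_mem_adm hr₁ (bih_le_adm hs')) (by ring) (by omega)
    obtain ⟨s, hs, rfl⟩ := exists_eq_X_pow_mul hN.one_le (j + 1) (m := j - a - b) (n := n - 4)
      (by omega) (bih_cast hs' rfl (by push_cast; ring))
    have hX : (X 0 ^ (j + 1) : MvPolynomial (Fin 4) ℂ) ≠ 0 := pow_ne_zero _ (X_ne_zero _)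
    have hu3 : u = q₂ * s := mul_left_cancel₀ hX (by rw [hu2]; ring)
    have hv3 : v = -(q₁ * s) := mul_left_cancel₀ hX (by rw [hv2]; ring)
    refine ⟨U' - r₂ * s, sub_mem (adm_cast hU' rfl (by push_cast; omega)) ?_,
      V' + r₁ * s, add_mem (adm_cast hV' rfl (by push_cast; omega)) ?_, ?_⟩
    · exact adm_cast (mul_mem_adm hr₂ (bih_le_adm hs)) (by ring) (by push_cast; omega)
    · exact adm_cast (mul_mem_adm hr₁ (bih_le_adm hs)) (by ring) (by push_cast; omega)
    · rw [hu3, hv3, hQ₁, hQ₂]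
      ring

end Presentation

end ScrollData

namespace Scroll

variable {e : Fin 3 → ℤ}

/-- The exponents of the monomials in the degree `d` piece of the section ring of
`O(1)(-H)`. -/
def Expo (e : Fin 3 → ℤ) (d : ℕ) : Set (Fin 4 →₀ ℕ) := {μ | wdeg μ = d ∧ d ≤ wt e μ}

theorem single_mem_expo {i : Fin 3} {j : ℕ} (h : (j : ℤ) + 1 ≤ e i) :
    Finsupp.single 0 j + Finsupp.single i.succ 1 ∈ Expo e 1 := by
  fin_cases i <;> simp [Expo, wdeg, wt] at h ⊢ <;> omega

theorem exists_eq_of_mem_expo_one (he : ∀ i, 1 ≤ e i) {μ : Fin 4 →₀ ℕ} (hμ : μ ∈ Expo e 1) :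
    ∃ (i : Fin 3) (j : ℕ), (j : ℤ) + 1 ≤ e i ∧
      Finsupp.single 0 j + Finsupp.single i.succ 1 = μ := by
  obtain ⟨h1, h2⟩ := hμ
  push_cast at h1 h2
  obtain ⟨i, hi⟩ := exists_pos_of_wdeg_pos (μ := μ) (by omega)
  obtain ⟨j, β, hj, hβ, hdeg, hwt, -⟩ := exists_factor he hi (by omega)
  have hβ0 : wdeg β = 0 := by omega
  have h0 : β = 0 := by
    have hb : β 1 = 0 ∧ β 2 = 0 ∧ β 3 = 0 := by
      unfold wdeg at hβ0
      omega
    rw [hβ0] at hwt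
    simp only [wt, hb] at hwt
    ext t
    fin_cases t
    · simp at hwt ⊢
      omega
    · exact hb.1
    · exact hb.2.1
    · exact hb.2.2
  exact ⟨i, j, hj, by rw [← hβ, h0, add_zero]⟩

variable {W : Type*} {d : ℕ} {b : (Fin 4 →₀ ℕ) → (Fin 4 →₀ ℕ) → W}

theorem eq_shift (he : ∀ i, 1 ≤ e i)
    (hb : ∀ α ∈ Expo e 1, ∀ α' ∈ Expo e 1, ∀ β ∈ Expo e 1, ∀ β' ∈ Expo e 1, ∀ t ∈ Expo e d,
      α + α' = β + β' → b α (α' + t) = b β (β' + t)) {i : Fin 3} {ν : Fin 4 →₀ ℕ} (k : ℕ) :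
    ∀ j : ℕ, (j : ℤ) + k + 1 ≤ e i → Finsupp.single 0 k + ν ∈ Expo e (d + 1) →
      b (Finsupp.single 0 j + Finsupp.single i.succ 1) (Finsupp.single 0 k + ν) =
        b (Finsupp.single 0 (j + k) + Finsupp.single i.succ 1) ν := by
  induction k with
  | zero => intro j _ _; simp
  | succ k ih =>
    intro j hj hν
    push_cast at hj
    set μ := Finsupp.single 0 (k + 1) + ν with hμ
    have hμ0 : 1 ≤ μ 0 := by simp [hμ]; omega
    obtain ⟨h1, h2⟩ := hν
    push_cast at h1 h2
    obtain ⟨l, hl, hel⟩ : ∃ l : Fin 3, 1 ≤ μ l.succ ∧ 2 ≤ e l := by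
      by_contra! h
      have key : ∀ l : Fin 3, (μ l.succ : ℤ) * e l ≤ μ l.succ := by
        intro l
        rcases Nat.eq_zero_or_pos (μ l.succ) with h0 | h0
        · simp [h0]
        · have := h l h0
          nlinarith
      have k0 : (μ 1 : ℤ) * e 0 ≤ μ 1 := key 0
      have k1 : (μ 2 : ℤ) * e 1 ≤ μ 2 := key 1
      have k2 : (μ 3 : ℤ) * e 2 ≤ μ 3 := key 2
      simp only [wdeg, wt] at h1 h2
      omega
    obtain ⟨p, β, hp, hβ, hdeg, hwt, hp1⟩ := exists_factor he hl (by omega)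
    obtain ⟨p, rfl⟩ : ∃ p', p = p' + 1 := ⟨p - 1, by have := hp1 hμ0 hel; omega⟩
    push_cast at hp
    have hν' : Finsupp.single 0 p + Finsupp.single l.succ 1 + β = Finsupp.single 0 k + ν := by
      have : Finsupp.single 0 1 + (Finsupp.single 0 p + Finsupp.single l.succ 1 + β) =
          Finsupp.single 0 1 + (Finsupp.single 0 k + ν) := by
        rw [← add_assoc, ← add_assoc, ← add_assoc, ← Finsupp.single_add, ← Finsupp.single_add,
          add_comm 1 p, add_comm 1 k, hβ]
      exact add_left_cancel this
    rw [← hβ, hb _ (single_mem_expo (by omega)) _ (single_mem_expo (by push_cast; omega))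
      (Finsupp.single 0 (j + 1) + Finsupp.single i.succ 1)
      (single_mem_expo (by push_cast; omega)) (Finsupp.single 0 p + Finsupp.single l.succ 1)
      (single_mem_expo (by omega)) β ⟨by omega, by omega⟩
      (by simp only [Finsupp.single_add]; abel), hν', ih (j + 1) (by push_cast; omega) ?_,
      add_assoc j, add_comm 1 k]
    have e1 := wdeg_add (Finsupp.single 0 1) (Finsupp.single 0 k + ν)
    have e2 := wt_add e (Finsupp.single 0 1) (Finsupp.single 0 k + ν)
    rw [← add_assoc, ← Finsupp.single_add, add_comm 1 k, ← hμ] at e1 e2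
    have e3 : wdeg (Finsupp.single 0 1) = 0 := by simp [wdeg]
    have e4 : wt e (Finsupp.single 0 1) = -1 := by simp [wt]
    constructor <;> push_cast <;> omega

theorem eq_of_add_eq_add (he : ∀ i, 1 ≤ e i)
    (hb : ∀ α ∈ Expo e 1, ∀ α' ∈ Expo e 1, ∀ β ∈ Expo e 1, ∀ β' ∈ Expo e 1, ∀ t ∈ Expo e d,
      α + α' = β + β' → b α (α' + t) = b β (β' + t)) {α α' ν ν' : Fin 4 →₀ ℕ}
    (hα : α ∈ Expo e 1) (hν : ν ∈ Expo e (d + 1)) (hα' : α' ∈ Expo e 1)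
    (hν' : ν' ∈ Expo e (d + 1)) (h : α + ν = α' + ν') : b α ν = b α' ν' := by
  have same : ∀ {i : Fin 3} {j j' : ℕ} {ν ν' : Fin 4 →₀ ℕ}, (j' : ℤ) + 1 ≤ e i → j ≤ j' →
      ν ∈ Expo e (d + 1) → Finsupp.single 0 j + Finsupp.single i.succ 1 + ν =
        Finsupp.single 0 j' + Finsupp.single i.succ 1 + ν' →
      b (Finsupp.single 0 j + Finsupp.single i.succ 1) ν =
        b (Finsupp.single 0 j' + Finsupp.single i.succ 1) ν' := by
    intro i j j' ν ν' hj' hjj hν h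
    obtain ⟨k, rfl⟩ := Nat.exists_eq_add_of_le hjj
    have hνν : ν = Finsupp.single 0 k + ν' := by
      refine add_left_cancel (a := Finsupp.single 0 j + Finsupp.single i.succ 1) ?_
      rw [h, Finsupp.single_add]
      abel
    subst hνν
    exact eq_shift he hb k j (by push_cast at hj'; omega) hν
  have same' : ∀ {i : Fin 3} {j j' : ℕ} {ν ν' : Fin 4 →₀ ℕ}, (j : ℤ) + 1 ≤ e i →
      (j' : ℤ) + 1 ≤ e i → ν ∈ Expo e (d + 1) → ν' ∈ Expo e (d + 1) →
      Finsupp.single 0 j + Finsupp.single i.succ 1 + ν =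
        Finsupp.single 0 j' + Finsupp.single i.succ 1 + ν' →
      b (Finsupp.single 0 j + Finsupp.single i.succ 1) ν =
        b (Finsupp.single 0 j' + Finsupp.single i.succ 1) ν' := by
    intro i j j' ν ν' hj hj' hν hν' h
    rcases le_total j j' with hjj | hjj
    · exact same hj' hjj hν h
    · exact (same hj hjj hν' h.symm).symm
  obtain ⟨i, j, hj, rfl⟩ := exists_eq_of_mem_expo_one he hα
  obtain ⟨i', j', hj', rfl⟩ := exists_eq_of_mem_expo_one he hα'
  by_cases hii : i = i'
  · subst hii
    exact same' hj hj' hν hν' h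
  · have hi' : 1 ≤ ν i'.succ := by
      have := DFunLike.congr_fun h i'.succ
      simp [hii] at this
      omega
    obtain ⟨h1, h2⟩ := hν
    obtain ⟨p, β, hp, rfl, hdeg, hwt, -⟩ := exists_factor he hi' (by omega)
    have hβ : β ∈ Expo e d := by
      push_cast at h1
      constructor <;> omega
    rw [hb _ hα _ (single_mem_expo hp) _ (single_mem_expo hp) _ hα β hβ (add_comm _ _)]
    refine same' hp hj' ?_ hν' ?_
    · have e1 := wdeg_add (Finsupp.single 0 j + Finsupp.single i.succ 1) β
      have e2 := wt_add e (Finsupp.single 0 j + Finsupp.single i.succ 1) β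
      have e3 := hα.1
      have e4 := hα.2
      have e5 := hβ.1
      have e6 := hβ.2
      push_cast at e3 e4
      constructor <;> push_cast <;> omega
    · rw [← h]
      abel

theorem adm_eq_restrictSupport (n : ℕ) : Adm e n n = restrictSupport ℂ (Expo e n) := rfl

theorem monomial_mem_adm {n : ℕ} {μ : Fin 4 →₀ ℕ} (h : μ ∈ Expo e n) :
    (monomial μ 1 : MvPolynomial (Fin 4) ℂ) ∈ Adm e n n := by
  rw [adm_eq_restrictSupport, monomial_mem_restrictSupport]
  exact Or.inl h

/-- A bilinear map which respects the quadratic monomial relations of the section ring of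
`O(1)(-H)` factors through the multiplication. -/
theorem exists_linearMap_mul {W : Type*} [AddCommGroup W] [Module ℂ W] (he : ∀ i, 1 ≤ e i)
    (B : MvPolynomial (Fin 4) ℂ →ₗ[ℂ] MvPolynomial (Fin 4) ℂ →ₗ[ℂ] W)
    (hB : ∀ α ∈ Expo e 1, ∀ α' ∈ Expo e 1, ∀ β ∈ Expo e 1, ∀ β' ∈ Expo e 1, ∀ t ∈ Expo e d,
      α + α' = β + β' → B (monomial α 1) (monomial (α' + t) 1) =
        B (monomial β 1) (monomial (β' + t) 1)) :
    ∃ Ψ : MvPolynomial (Fin 4) ℂ →ₗ[ℂ] W, ∀ l ∈ Adm e (1 : ℕ) (1 : ℕ),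
      ∀ p ∈ Adm e (d + 1 : ℕ) (d + 1 : ℕ), Ψ (l * p) = B l p := by
  classical
  let c : (Fin 4 →₀ ℕ) → W := fun μ =>
    if h : ∃ x : (Fin 4 →₀ ℕ) × (Fin 4 →₀ ℕ),
      x.1 ∈ Expo e 1 ∧ x.2 ∈ Expo e (d + 1) ∧ x.1 + x.2 = μ
    then B (monomial h.choose.1 1) (monomial h.choose.2 1) else 0
  have hc : ∀ α ∈ Expo e 1, ∀ ν ∈ Expo e (d + 1),
      c (α + ν) = B (monomial α 1) (monomial ν 1) := by
    intro α hα ν hν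
    have h : ∃ x : (Fin 4 →₀ ℕ) × (Fin 4 →₀ ℕ),
        x.1 ∈ Expo e 1 ∧ x.2 ∈ Expo e (d + 1) ∧ x.1 + x.2 = α + ν := ⟨(α, ν), hα, hν, rfl⟩
    obtain ⟨h1, h2, h3⟩ := h.choose_spec
    simp only [c, dif_pos h]
    exact eq_of_add_eq_add (b := fun μ ν => B (monomial μ 1) (monomial ν 1)) he hB h1 h2 hα hν h3
  refine ⟨(basisMonomials (Fin 4) ℂ).constr ℂ c, fun l hl p hp => ?_⟩
  have hΨ : ∀ μ, (basisMonomials (Fin 4) ℂ).constr ℂ c (monomial μ 1) = c μ := by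
    intro μ
    have := (basisMonomials (Fin 4) ℂ).constr_basis ℂ c μ
    rwa [coe_basisMonomials] at this
  rw [adm_eq_restrictSupport, restrictSupport_eq_span] at hl hp
  induction hl, hp using Submodule.span_induction₂ with
  | mem_mem x y hx hy =>
    obtain ⟨α, hα, rfl⟩ := hx
    obtain ⟨ν, hν, rfl⟩ := hy
    change (basisMonomials (Fin 4) ℂ).constr ℂ c (monomial α 1 * monomial ν 1) =
      B (monomial α 1) (monomial ν 1)
    rw [monomial_mul, one_mul, hΨ, hc α hα ν hν]
  | zero_left => simp
  | zero_right => simp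
  | add_left x y z _ _ _ h1 h2 => simp only [add_mul, map_add, LinearMap.add_apply, h1, h2]
  | add_right x y z _ _ _ h1 h2 => simp only [mul_add, map_add, h1, h2]
  | smul_left r x y _ _ h => simp only [smul_mul_assoc, map_smul, LinearMap.smul_apply, h]
  | smul_right r x y _ _ h => simp only [mul_smul_comm, map_smul, h]

/-- The sections of `O(d)((k - d)H)` are generated by those of `O(d)(-dH)`. -/
theorem adm_le_mul (he : ∀ i, 1 ≤ e i) {d k : ℤ} (hk : 0 ≤ k) :
    Adm e d (d - k) ≤ Adm e 0 (-k) * Adm e d d := by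
  conv_lhs => rw [Adm, restrictSupport_eq_span]
  rw [Submodule.span_le]
  rintro _ ⟨μ, ⟨h1, h2⟩, rfl⟩
  have hw := wdeg_le_of_one_le he μ
  have hμ := sub_single_zero_add (min_le_left (μ 0) k.toNat)
  set β := μ - Finsupp.single 0 (min (μ 0) k.toNat) with hβ
  have : monomial μ (1 : ℂ) = monomial (Finsupp.single 0 (min (μ 0) k.toNat)) 1 * monomial β 1 := by
    rw [monomial_mul, one_mul, hμ]
  change monomial μ (1 : ℂ) ∈ _
  rw [this]
  have e1 := wdeg_add (Finsupp.single 0 (min (μ 0) k.toNat)) β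
  have e2 := wt_add e (Finsupp.single 0 (min (μ 0) k.toNat)) β
  have e3 : wdeg (Finsupp.single 0 (min (μ 0) k.toNat)) = 0 := by simp [wdeg]
  have e4 : wt e (Finsupp.single 0 (min (μ 0) k.toNat)) = -(min (μ 0) k.toNat : ℕ) := by
    simp [wt]
  rw [hμ] at e1 e2
  refine Submodule.mul_mem_mul ?_ ?_
  · rw [Adm, monomial_mem_restrictSupport]
    left
    exact ⟨e3, by rw [e4]; omega⟩
  · rw [Adm, monomial_mem_restrictSupport]
    left
    constructor <;> omega

end Scroll

theorem Module.exists_ker_eq {k V : Type} [Field k] [AddCommMonoid V] [Module k V]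
    (Z : Submodule k V) : ∃ (W : Type) (_ : AddCommGroup W) (_ : Module k W) (π : V →ₗ[k] W),
      ∀ z, π z = 0 ↔ z ∈ Z := by
  let := Module.addCommMonoidToAddCommGroup k (M := V)
  exact ⟨V ⧸ Z, inferInstance, inferInstance, Z.mkQ, fun z => Submodule.Quotient.mk_eq_zero Z⟩

namespace ScrollData

variable {C : Curve} {T : C.Div} {e : Fin 3 → ℤ} {sd : ScrollData C T e}
  {a b : ℤ} {Q₁ Q₂ : MvPolynomial (Fin 4) ℂ}

theorem _root_.Curve.connectedOne_RL (C : Curve) (L : C.Div) : (C.RL L).ConnectedOne := by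
  have h0 : (C.RL L).piece 0 = C.H0 0 := by
    change C.H0 ((0 : ℕ) • L) = _
    rw [zero_smul]
  have h1 : (1 : C.F) ∈ C.H0 0 := h0 ▸ (C.RL L).one_mem
  have ht : Module.finrank ℂ (C.H0 0) = 1 := C.h0_triv
  rw [GradedSystem.ConnectedOne, h0]
  refine (Submodule.eq_of_le_of_finrank_le ?_ ?_).symm
  · rw [Submodule.span_singleton_le_iff_mem]
    exact h1
  · rw [ht, finrank_span_singleton one_ne_zero]

/-- The linear map sending a polynomial in the section ring of the scroll to its restriction
to the curve. -/
theorem Numerics.exists_res (hN : sd.Numerics) (n : ℕ) :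
    ∃ s : MvPolynomial (Fin 4) ℂ →ₗ[ℂ] (C.RL (C.K - T)).piece n,
      ∀ p ∈ Adm e n n, (s p : C.F) = sd.ev p := by
  obtain ⟨σ, hσ⟩ := ((C.RL (C.K - T)).piece n).subtype.exists_leftInverse_of_injective
    (Submodule.ker_subtype _)
  refine ⟨σ ∘ₗ sd.ev.toLinearMap, fun p hp => ?_⟩
  have h : sd.ev p ∈ (C.RL (C.K - T)).piece n := by
    rw [piece_eq]
    exact hN.ev_mem hp
  exact congrArg Subtype.val (LinearMap.congr_fun hσ ⟨sd.ev p, h⟩)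

namespace Presentation

theorem map_adm_piece (h : sd.Presentation a b Q₁ Q₂) (hN : sd.Numerics)
    (hab : a + b = (C.genus : ℤ) - 5) (ha : 2 ≤ a) (hb : 2 ≤ b) (n : ℕ) :
    (Adm e n n).map sd.ev.toLinearMap = (C.RL (C.K - T)).piece n := by
  rcases Nat.lt_or_ge n 2 with hn | hn
  · interval_cases n
    · refine le_antisymm (by rw [piece_eq]; exact hN.map_adm_le _ _) ?_
      rw [show _ = _ from Curve.connectedOne_RL C _, Submodule.span_singleton_le_iff_mem]
      refine ⟨1, ?_, map_one sd.ev⟩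
      simpa using bih_le_adm (e := e) (X_pow_mem_bih 0)
    · rw [piece_eq]
      exact hN.map_adm_one
  · rw [piece_eq]
    exact h.map_adm_nat hN hab ha hb (by exact_mod_cast hn) n le_rfl

theorem vanishing_le_mul (h : sd.Presentation a b Q₁ Q₂) (hN : sd.Numerics)
    (hab : a + b = (C.genus : ℤ) - 5) (ha : 2 ≤ a) (hb : 2 ≤ b) (d : ℕ) :
    sd.vanishing (d + 2 : ℕ) (d + 2 : ℕ) ≤ sd.vanishing 2 2 * Adm e d d := by
  have key : ∀ {a : ℤ} {Q U : MvPolynomial (Fin 4) ℂ}, 2 ≤ a → Q ∈ sd.vanishing 2 a →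
      U ∈ Adm e ((d + 2 : ℕ) - 2) ((d + 2 : ℕ) - a) →
      Q * U ∈ sd.vanishing 2 2 * Adm e d d := by
    intro a Q U ha hQ hU
    have hU' := adm_le_mul hN.one_le (d := d) (k := a - 2) (by omega)
      (adm_cast hU (by push_cast; ring) (by push_cast; omega))
    clear hU
    refine Submodule.mul_induction_on hU' ?_ ?_
    · intro x hx y hy
      rw [← mul_assoc]
      refine Submodule.mul_mem_mul ?_ hy
      have := mul_mem_vanishing hQ hx
      rwa [add_zero, ← sub_eq_add_neg, sub_sub_cancel] at this
    · intro x y hx hy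
      rw [mul_add]
      exact add_mem hx hy
  intro p hp
  obtain ⟨U, hU, V, hV, rfl⟩ := h.exists_of_mem_nat hN hab ha hb (by push_cast; omega) (d + 2)
    le_rfl p hp
  exact add_mem (key ha h.mem₁ hU) (key hb h.mem₂ hV)

theorem isQuadratic (h : sd.Presentation a b Q₁ Q₂) (hN : sd.Numerics)
    (hab : a + b = (C.genus : ℤ) - 5) (ha : 2 ≤ a) (hb : 2 ≤ b) :
    (C.RL (C.K - T)).IsQuadratic := by
  set S := C.RL (C.K - T)
  have he := hN.one_le
  have hmap := h.map_adm_piece hN hab ha hb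
  have : FiniteDimensional ℂ (S.piece 1) := inferInstanceAs (FiniteDimensional ℂ (C.H0 _))
  choose s hs using hN.exists_res
  have hsurj : ∀ n (y : S.piece n), ∃ p ∈ Adm e n n, s n p = y := by
    intro n y
    obtain ⟨p, hp, hpy⟩ := (hmap n).ge y.2
    exact ⟨p, hp, Subtype.ext ((hs n p hp).trans hpy)⟩
  have hmul : ∀ {d : ℕ} {l p : MvPolynomial (Fin 4) ℂ}, l ∈ Adm e (1 : ℕ) (1 : ℕ) →
      p ∈ Adm e d d → l * p ∈ Adm e (d + 1 : ℕ) (d + 1 : ℕ) := fun hl hp =>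
    adm_cast (mul_mem_adm hl hp) (by push_cast; ring) (by push_cast; omega)
  have hlin : ∀ {d : ℕ} {l p : MvPolynomial (Fin 4) ℂ}, l ∈ Adm e (1 : ℕ) (1 : ℕ) →
      p ∈ Adm e d d → S.linMul d (s 1 l ⊗ₜ s d p) = s (d + 1) (l * p) := by
    intro d l p hl hp
    refine Subtype.ext ?_
    rw [GradedSystem.linMul_tmul, hs _ _ hl, hs _ _ hp, hs _ _ (hmul hl hp), map_mul]
  refine GradedSystem.isQuadratic_of S (Curve.connectedOne_RL C _) ?_ ?_
  · intro d y
    obtain ⟨p, hp, rfl⟩ := hsurj _ y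
    have hp' := adm_succ_le_mul he (d := d) (by omega) (adm_cast hp (by push_cast; ring) (by simp))
    clear hp
    refine Submodule.mul_induction_on hp' ?_ ?_
    · intro l hl p hp
      exact ⟨_, hlin hl hp⟩
    · intro x y hx hy
      obtain ⟨x', hx'⟩ := hx
      obtain ⟨y', hy'⟩ := hy
      exact ⟨x' + y', by rw [map_add, map_add, hx', hy']⟩
  · intro d z hz
    set Z := Submodule.span ℂ {y | ∃ t ∈ LinearMap.ker (S.linMul 1), ∃ r : S.piece d,
      y = S.freeMul (S.piece 1) d (t ⊗ₜ r)}
    obtain ⟨W, _, _, π, hπ⟩ := Module.exists_ker_eq Z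
    let B : MvPolynomial (Fin 4) ℂ →ₗ[ℂ] MvPolynomial (Fin 4) ℂ →ₗ[ℂ]
        W :=
      ((TensorProduct.mk ℂ (S.piece 1) (S.piece (d + 1))).compl₁₂ (s 1) (s (d + 1))).compr₂ π
    have hB : ∀ l p, B l p = π (s 1 l ⊗ₜ s (d + 1) p) := fun _ _ => rfl
    have hBmul : ∀ {l l' t : MvPolynomial (Fin 4) ℂ}, l' ∈ Adm e (1 : ℕ) (1 : ℕ) →
        t ∈ Adm e d d →
        B l (l' * t) = π (S.freeMul (S.piece 1) d ((s 1 l ⊗ₜ s 1 l') ⊗ₜ s d t)) := by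
      intro l l' t hl' ht
      rw [hB, GradedSystem.freeMul_tmul, hlin hl' ht]
    have hkill : ∀ τ : S.piece 1 ⊗[ℂ] S.piece 1, S.linMul 1 τ = 0 → ∀ r : S.piece d,
        π (S.freeMul (S.piece 1) d (τ ⊗ₜ r)) = 0 := by
      intro τ hτ r
      rw [hπ]
      exact Submodule.subset_span ⟨τ, hτ, r, rfl⟩
    have hrel : ∀ τ τ' : S.piece 1 ⊗[ℂ] S.piece 1, S.linMul 1 τ = S.linMul 1 τ' →
        ∀ r : S.piece d, π (S.freeMul (S.piece 1) d (τ ⊗ₜ r)) =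
          π (S.freeMul (S.piece 1) d (τ' ⊗ₜ r)) := by
      intro τ τ' hτ r
      have h0 := hkill (τ + (-1 : ℂ) • τ') (by
        rw [map_add, map_smul, hτ]
        exact Subtype.ext (by simp)) r
      rw [TensorProduct.add_tmul, ← TensorProduct.smul_tmul', map_add, map_add, map_smul, map_smul,
        neg_one_smul, ← sub_eq_add_neg, sub_eq_zero] at h0
      exact h0
    obtain ⟨Ψ, hΨ⟩ := exists_linearMap_mul he B (by
      intro α hα α' hα' β hβ β' hβ' t ht hαβ
      have hm : ∀ μ, (monomial (μ + t) 1 : MvPolynomial (Fin 4) ℂ) =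
          monomial μ 1 * monomial t 1 := fun μ => by rw [monomial_mul, one_mul]
      rw [hm, hm, hBmul (monomial_mem_adm hα') (monomial_mem_adm ht),
        hBmul (monomial_mem_adm hβ') (monomial_mem_adm ht)]
      refine hrel _ _ ?_ _
      rw [hlin (monomial_mem_adm hα) (monomial_mem_adm hα'),
        hlin (monomial_mem_adm hβ) (monomial_mem_adm hβ'), monomial_mul, monomial_mul, hαβ])
    have hquad : ∀ q ∈ Adm e 2 2, ∃ τ : S.piece 1 ⊗[ℂ] S.piece 1,
        (S.linMul 1 τ : C.F) = sd.ev q ∧ ∀ t ∈ Adm e d d,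
          Ψ (q * t) = π (S.freeMul (S.piece 1) d (τ ⊗ₜ s d t)) := by
      intro q hq
      have hq' := adm_succ_le_mul he (d := 1) (by norm_num) hq
      clear hq
      refine Submodule.mul_induction_on hq' ?_ ?_
      · intro l hl l' hl'
        refine ⟨s 1 l ⊗ₜ s 1 l', ?_, fun t ht => ?_⟩
        · rw [hlin hl hl', hs _ _ (hmul hl hl')]
        · rw [mul_assoc, hΨ l hl _ (hmul hl' ht), hBmul hl' ht]
      · intro x y hx hy
        obtain ⟨τ, h1, h2⟩ := hx
        obtain ⟨τ', h1', h2'⟩ := hy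
        refine ⟨τ + τ', ?_, fun t ht => ?_⟩
        · rw [map_add, Submodule.coe_add, h1, h1', map_add]
        · rw [add_mul, map_add, h2 t ht, h2' t ht, TensorProduct.add_tmul, map_add, map_add]
    have hvan : ∀ p ∈ sd.vanishing (d + 2 : ℕ) (d + 2 : ℕ), Ψ p = 0 := by
      intro p hp
      have hp' := h.vanishing_le_mul hN hab ha hb d hp
      clear hp
      refine Submodule.mul_induction_on hp' ?_ ?_
      · intro q hq t ht
        obtain ⟨τ, h1, h2⟩ := hquad q hq.1
        rw [h2 t ht]
        exact hkill τ (Subtype.ext (h1.trans (mem_vanishing.mp hq).2)) _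
      · intro x y hx hy
        rw [map_add, hx, hy, add_zero]
    have hlift : ∀ z : S.piece 1 ⊗[ℂ] S.piece (d + 1), ∃ p ∈ Adm e (d + 2 : ℕ) (d + 2 : ℕ),
        sd.ev p = S.linMul (d + 1) z ∧ Ψ p = π z := by
      intro z
      induction z with
      | zero => exact ⟨0, zero_mem _, by simp, by simp⟩
      | add x y hx hy =>
        obtain ⟨p, hp, h1, h2⟩ := hx
        obtain ⟨p', hp', h1', h2'⟩ := hy
        exact ⟨p + p', add_mem hp hp', by rw [map_add, map_add, h1, h1', Submodule.coe_add],
          by rw [map_add, map_add, h2, h2']⟩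
      | tmul x y =>
        obtain ⟨l, hl, rfl⟩ := hsurj _ x
        obtain ⟨p, hp, rfl⟩ := hsurj _ y
        refine ⟨l * p, hmul hl hp, ?_, ?_⟩
        · rw [hlin hl hp, hs _ _ (hmul hl hp)]
        · rw [hΨ l hl p hp, hB]
    obtain ⟨p, hp, h1, h2⟩ := hlift z
    have h3 := hvan p (mem_vanishing.mpr ⟨hp, by rw [h1, hz]; rfl⟩)
    rw [h2, hπ] at h3
    exact h3

end Presentation

end ScrollData

end

/-!  ### STATEMENT 13

Let `C` be a non-hyperelliptic smooth connected projective complex curve of genus `g`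
with a base-point-free tetragonal system `T` such that `h⁰(2T) = 3`, presented as a
complete intersection of divisors in `|O_X(2)(-aH)|` and `|O_X(2)(-bH)|` on the
3-dimensional rational normal scroll `X = P(V^∨)` with `a + b = g - 5` and `T = H|_C`.
Then the algebra `R_{K(-T)} = ⊕_{n≥0} H⁰(C, (K(-T))ⁿ)` is quadratic if and only if
`a ≥ 2` and `b ≥ 2`. -/
theorem tetragonal_quadratic_iff (C : Curve) (T : C.Div)
    (hHE : ¬ C.Hyperelliptic)
    (hTdeg : C.deg T = 4) (hTh0 : C.h0 T = 2) (hTbpf : C.BasePointFree T)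
    (hTeff : ∀ P, 0 ≤ T P) (h2T : C.h0 (2 • T) = 3)
    (e : Fin 3 → ℤ) (a b : ℤ) (hab : a + b = (C.genus : ℤ) - 5)
    (sd : ScrollData C T e) (Q₁ Q₂ : MvPolynomial (Fin 4) ℂ)
    (hCI : sd.CI a b Q₁ Q₂) :
    (C.RL (C.K - T)).IsQuadratic ↔ (2 ≤ a ∧ 2 ≤ b) := by
  have hN := sd.numerics hTdeg hTh0 hTeff h2T
  have h := hCI.presentation
  refine ⟨fun hq => ?_, fun ⟨ha, hb⟩ => h.isQuadratic hN hab ha hb⟩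
  exact ⟨h.two_le_of_isQuadratic hN hab hq,
    h.symm.two_le_of_isQuadratic hN ((add_comm b a).trans hab) hq⟩

end
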